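/- arXiv:1111.5403 — 3 statements merged into one kernel-verified Lean document; each statement's English description precedes it below -/
import Mathlib

section
/- Let p be a prime and n a positive integer. Then n is p-practical if and only if every integer m with 1 ≤ m ≤ n can be written as m = Σ_{d | n} ℓ*_p(d)·n_d, where for each divisor d of n, n_d is an integer satisfying 0 ≤ n_d ≤ φ(d)/ℓ*_p(d). -/
open Polynomial

/-- `n` is `p`-practical if `x^n - 1` has a divisor in `𝔽_p[x]` of every degree
between `1` and `n`. -/
def IsPPractical (p n : ℕ) : Prop :=
  ∀ m : ℕ, 1 ≤ m → m ≤ n → ∃ g : Polynomial (ZMod p), g ∣ X ^ n - 1 ∧ g.natDegree = m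

/-- The largest divisor of `n` coprime to `a`. -/
def coprimePart (a n : ℕ) : ℕ :=
  (n.divisors.filter fun d => Nat.Coprime d a).sup id

/-- `ℓ*_a(n)`: the multiplicative order of `a` modulo the largest divisor of `n`
coprime to `a`. -/
noncomputable def lstar (a n : ℕ) : ℕ :=
  orderOf (a : ZMod (coprimePart a n))

lemma coprimePart_eq (p : ℕ) (hp : p.Prime) (k m : ℕ) (hm : ¬ p ∣ m) :
    coprimePart p (p ^ k * m) = m := by
  have hm0 : m ≠ 0 := by rintro rfl; simp at hm
  have hpk : p ^ k * m ≠ 0 := mul_ne_zero (pow_ne_zero _ hp.ne_zero) hm0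
  unfold coprimePart
  apply le_antisymm
  · apply Finset.sup_le
    intro d hd
    simp only [Finset.mem_filter, Nat.mem_divisors] at hd
    exact Nat.le_of_dvd (Nat.pos_of_ne_zero hm0)
      ((hd.2.pow_right k).dvd_of_dvd_mul_left hd.1.1)
  · have : m ∈ ((p ^ k * m).divisors.filter fun d => Nat.Coprime d p) := by
      simp only [Finset.mem_filter, Nat.mem_divisors]
      exact ⟨⟨Dvd.intro_left _ rfl, hpk⟩, ((Nat.Prime.coprime_iff_not_dvd hp).2 hm).symm⟩
    exact Finset.le_sup (f := id) this

lemma natDegree_factor (p : ℕ) [hp : Fact p.Prime] (d : ℕ) (hd : d ≠ 0) (q : (ZMod p)[X])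
    (hq : Irreducible q) (hqd : q ∣ cyclotomic d (ZMod p)) : q.natDegree = lstar p d := by
  obtain ⟨k, m, hm, rfl⟩ := Nat.exists_eq_pow_mul_and_not_dvd hd p hp.out.ne_one
  have hqm : q ∣ cyclotomic m (ZMod p) := by
    rcases Nat.eq_zero_or_pos k with rfl | hk
    · simpa using hqd
    · rw [cyclotomic_mul_prime_pow_eq (ZMod p) hm hk] at hqd
      exact hq.prime.dvd_of_dvd_pow hqd
  have hc : p.Coprime m := (Nat.Prime.coprime_iff_not_dvd hp.out).2 hm
  rw [lstar, coprimePart_eq p hp.out k m hm,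
    natDegree_of_dvd_cyclotomic_of_irreducible (p := p) (f := 1) (by simp) hc hqm hq]
  simpa using (orderOf_injective _ Units.coeHom_injective (ZMod.unitOfCoprime p hc)).symm

lemma lstar_pos (p : ℕ) [hp : Fact p.Prime] (d : ℕ) (hd : d ≠ 0) : 0 < lstar p d := by
  have h : ¬ IsUnit (cyclotomic d (ZMod p)) := by
    intro h
    have := natDegree_eq_zero_of_isUnit h
    rw [natDegree_cyclotomic] at this
    have := Nat.totient_pos.2 (Nat.pos_of_ne_zero hd)
    omega
  obtain ⟨q, hq, hqd⟩ := WfDvdMonoid.exists_irreducible_factor h (cyclotomic_ne_zero _ _)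
  rw [← natDegree_factor p d hd q hq hqd]
  exact hq.natDegree_pos

lemma degrees {K : Type*} [Field K] (l : ℕ) (P : K[X]) (hP : P ≠ 0)
    (h : ∀ q, Irreducible q → q ∣ P → q.natDegree = l) :
    ∃ N, P.natDegree = l * N ∧ ∀ k ≤ N, ∃ g, g ∣ P ∧ g.natDegree = l * k := by
  induction P using WfDvdMonoid.induction_on_irreducible with
  | zero => exact absurd rfl hP
  | unit u hu =>
    refine ⟨0, by simp [natDegree_eq_zero_of_isUnit hu], fun k hk => ⟨1, one_dvd _, ?_⟩⟩
    simp [Nat.le_zero.1 hk]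
  | mul a i ha hi ih =>
    obtain ⟨N, hN, hg⟩ := ih ha (fun q hq hqa => h q hq (hqa.mul_left i))
    have hdeg : (i * a).natDegree = l * (N + 1) := by
      rw [natDegree_mul hi.ne_zero ha, hN, h i hi (dvd_mul_right _ _)]; ring
    refine ⟨N + 1, hdeg, fun k hk => ?_⟩
    rcases Nat.lt_or_ge N k with hk' | hk'
    · obtain rfl : k = N + 1 := by omega
      exact ⟨_, dvd_rfl, hdeg⟩
    · obtain ⟨g, h1, h2⟩ := hg k hk'
      exact ⟨g, h1.mul_left i, h2⟩

theorem stmt1 (p : ℕ) (hp : p.Prime) (n : ℕ) (hn : 0 < n) :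
    IsPPractical p n ↔
      ∀ m : ℕ, 1 ≤ m → m ≤ n → ∃ f : ℕ → ℕ,
        (∀ d ∈ n.divisors, f d ≤ d.totient / lstar p d) ∧
        m = ∑ d ∈ n.divisors, lstar p d * f d := by
  have : Fact p.Prime := ⟨hp⟩
  have key : ∀ m : ℕ, (∃ g : Polynomial (ZMod p), g ∣ X ^ n - 1 ∧ g.natDegree = m) ↔
      ∃ f : ℕ → ℕ, (∀ d ∈ n.divisors, f d ≤ d.totient / lstar p d) ∧
        m = ∑ d ∈ n.divisors, lstar p d * f d := by
    intro m
    rw [← prod_cyclotomic_eq_X_pow_sub_one hn (ZMod p)]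
    have hd0 : ∀ d ∈ n.divisors, d ≠ 0 := fun d hd => (Nat.pos_of_mem_divisors hd).ne'
    constructor
    · rintro ⟨g, hg, rfl⟩
      have step : ∀ s : Finset ℕ, (∀ d ∈ s, d ≠ 0) → ∀ g : (ZMod p)[X],
          g ∣ ∏ d ∈ s, cyclotomic d (ZMod p) → ∃ f : ℕ → ℕ,
          (∀ d ∈ s, f d ≤ d.totient / lstar p d) ∧
          g.natDegree = ∑ d ∈ s, lstar p d * f d := by
        intro s
        induction s using Finset.induction_on with
        | empty =>
          intro _ g hg
          refine ⟨0, by simp, ?_⟩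
          simp only [Finset.prod_empty] at hg
          simp [natDegree_eq_zero_of_isUnit (isUnit_of_dvd_one hg)]
        | insert a s ha ih =>
          intro hs g hg
          rw [Finset.prod_insert ha] at hg
          obtain ⟨g1, g2, h1, h2, rfl⟩ := exists_dvd_and_dvd_of_dvd_mul hg
          obtain ⟨f, hf, hf2⟩ := ih (fun d hd => hs d (Finset.mem_insert_of_mem hd)) g2 h2
          have ha0 := hs a (Finset.mem_insert_self _ _)
          have g10 : g1 ≠ 0 := ne_zero_of_dvd_ne_zero (cyclotomic_ne_zero _ _) h1
          have g20 : g2 ≠ 0 := ne_zero_of_dvd_ne_zero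
            (Finset.prod_ne_zero_iff.2 fun d _ => cyclotomic_ne_zero _ _) h2
          obtain ⟨N, hN, -⟩ := degrees (lstar p a) g1 g10
            (fun q hq hqg => natDegree_factor p a ha0 q hq (hqg.trans h1))
          have hle := natDegree_le_of_dvd h1 (cyclotomic_ne_zero _ _)
          rw [natDegree_cyclotomic, hN] at hle
          refine ⟨Function.update f a N, ?_, ?_⟩
          · intro d hd
            rcases Finset.mem_insert.1 hd with rfl | hds
            · rw [Function.update_self, Nat.le_div_iff_mul_le (lstar_pos p d ha0), mul_comm]
              exact hle
            · rw [Function.update_of_ne (by rintro rfl; exact ha hds)]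
              exact hf d hds
          · rw [natDegree_mul g10 g20, Finset.sum_insert ha, Function.update_self, hN, hf2]
            congr 1
            apply Finset.sum_congr rfl
            intro d hd
            rw [Function.update_of_ne (by rintro rfl; exact ha hd)]
      exact step _ hd0 g hg
    · rintro ⟨f, hf, rfl⟩
      have : ∀ d ∈ n.divisors, ∃ g : (ZMod p)[X], g ∣ cyclotomic d (ZMod p) ∧
          g.natDegree = lstar p d * f d := by
        intro d hd
        obtain ⟨N, hN, h⟩ := degrees (lstar p d) (cyclotomic d (ZMod p)) (cyclotomic_ne_zero _ _)
          (natDegree_factor p d (hd0 d hd))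
        rw [natDegree_cyclotomic] at hN
        apply h
        have := hf d hd
        rwa [hN, Nat.mul_div_cancel_left _ (lstar_pos p d (hd0 d hd))] at this
      choose! G hG1 hG2 using this
      refine ⟨∏ d ∈ n.divisors, G d, Finset.prod_dvd_prod_of_dvd _ _ hG1, ?_⟩
      rw [natDegree_prod _ _ fun d hd =>
        ne_zero_of_dvd_ne_zero (cyclotomic_ne_zero d (ZMod p)) (hG1 d hd)]
      exact Finset.sum_congr rfl hG2
  unfold IsPPractical
  simp only [key]
end

section
/- There is an absolute constant C such that for all real X ≥ 1 and all primes q ≥ 3, the number of positive integers n ≤ X divisible by some prime r with r ≡ 1 (mod q) and q²/(4(log q)²) < r ≤ q²(log q)⁴ is at most C·X·log log(q+16)/(q log q). -/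
open Finset

lemma aux_cnt (q δ a N : ℕ) (h : Nat.Coprime q δ) (hδ : 0 < δ) :
    |((#{m ∈ Ico a (a+N) | δ ∣ q*m+1} : ℕ) : ℝ) - N/δ| ≤ 1 := by
  obtain ⟨v, hv⟩ : ∃ v : ℕ, q * v + 1 ≡ 0 [MOD δ] := by
    obtain ⟨w, hw⟩ := Nat.exists_mul_mod_eq_of_coprime (δ - 1) h hδ.ne'
    refine ⟨w, ?_⟩
    have h1 : q * w ≡ δ - 1 [MOD δ] := hw.2
    have h2 := h1.add_right 1
    rw [Nat.sub_add_cancel hδ] at h2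
    exact h2.trans (by simp [Nat.ModEq])
  have heq : {m ∈ Ico a (a+N) | δ ∣ q*m+1} = {m ∈ Ico a (a+N) | m ≡ v [MOD δ]} := by
    apply Finset.filter_congr
    intro m _
    rw [← Nat.modEq_zero_iff_dvd]
    constructor
    · intro hm
      have h3 := (hm.trans hv.symm)
      have h4 := Nat.ModEq.add_right_cancel' 1 h3
      exact Nat.ModEq.cancel_left_of_coprime (by rwa [Nat.coprime_comm] at h) h4
    · intro hm
      exact ((hm.mul_left q).add_right 1).trans hv
  rw [heq]
  have h5 := Nat.Ico_filter_modEq_card a (a+N) hδ v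
  set c := #{m ∈ Ico a (a+N) | m ≡ v [MOD δ]}
  have hδ' : (0:ℚ) < δ := by exact_mod_cast hδ
  have key : |(c:ℚ) - N/δ| ≤ 1 := by
    have e : (((a+N:ℕ):ℚ) - v)/δ = ((a:ℚ)-v)/δ + N/δ := by push_cast; ring
    rw [e] at h5
    set x := ((a:ℚ)-v)/δ
    set y := (N:ℚ)/δ with hy
    have hy0 : 0 ≤ y := by positivity
    rw [max_eq_left (by
      rw [sub_nonneg]; apply Int.ceil_mono; linarith)] at h5
    have h6 : (c:ℚ) = (⌈x+y⌉:ℚ) - ⌈x⌉ := by exact_mod_cast congrArg (Int.cast (R:=ℚ)) h5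
    rw [h6, abs_le]
    have := Int.le_ceil x
    have := Int.ceil_lt_add_one x
    have := Int.le_ceil (x+y)
    have := Int.ceil_lt_add_one (x+y)
    constructor <;> linarith
  have h7 : ((|(c:ℚ) - N/δ| : ℚ) : ℝ) ≤ ((1:ℚ):ℝ) := by exact_mod_cast key
  push_cast at h7
  exact h7

open ArithmeticFunction in
lemma aux_moeb (l e : ℕ) (hl : 0 < l) :
    ∑ d ∈ l.divisors, (if e ∣ d then (moebius (l/d) : ℝ) else 0) = if e = l then 1 else 0 := by
  by_cases hel : e ∣ l
  · obtain ⟨k, rfl⟩ := hel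
    have he : 0 < e := Nat.pos_of_mul_pos_right hl
    have hk : 0 < k := Nat.pos_of_mul_pos_left hl
    rw [← Finset.sum_filter]
    have : (filter (fun d => e ∣ d) (e*k).divisors) = k.divisors.image (fun j => e * j) := by
      ext d
      simp only [mem_filter, Nat.mem_divisors, mem_image]
      constructor
      · rintro ⟨⟨h1, _⟩, ⟨j, rfl⟩⟩
        exact ⟨j, ⟨Nat.dvd_of_mul_dvd_mul_left he h1, hk.ne'⟩, rfl⟩
      · rintro ⟨j, ⟨h1, _⟩, rfl⟩
        exact ⟨⟨Nat.mul_dvd_mul_left e h1, hl.ne'⟩, dvd_mul_right _ _⟩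
    rw [this, Finset.sum_image (by
      intro x _ y _ h
      exact Nat.eq_of_mul_eq_mul_left he h)]
    have h2 : ∀ j ∈ k.divisors, (moebius (e*k/(e*j)) : ℝ) = ((fun i => (moebius i : ℝ)) (k/j)) := by
      intro j _
      rw [Nat.mul_div_mul_left _ _ he]
    rw [Finset.sum_congr rfl h2, Nat.sum_div_divisors k (fun i => (moebius i : ℝ))]
    have h3 : ∑ i ∈ k.divisors, moebius i = if k = 1 then 1 else 0 := by
      rw [← coe_mul_zeta_apply, moebius_mul_coe_zeta, one_apply]
    have h4 : ∑ i ∈ k.divisors, (moebius i : ℝ) = if k = 1 then 1 else 0 := by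
      exact_mod_cast congrArg (Int.cast (R:=ℝ)) h3
    rw [h4]
    congr 1
    simp [he.ne']
  · rw [if_neg (by rintro rfl; exact hel dvd_rfl)]
    apply Finset.sum_eq_zero
    intro d hd
    rw [if_neg]
    intro h
    exact hel (h.trans (Nat.dvd_of_mem_divisors hd))

open ArithmeticFunction in
lemma aux_orth (l l' : ℕ) (hl : 0 < l) (hl' : 0 < l') :
    ∑ d ∈ l.divisors, ∑ d' ∈ l'.divisors,
      (moebius (l/d) : ℝ) * (moebius (l'/d') : ℝ) * (Nat.gcd d d' : ℝ) =
      if l = l' then (Nat.totient l : ℝ) else 0 := by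
  have hg : ∀ d ∈ l.divisors, ∀ d' : ℕ, (Nat.gcd d d' : ℝ) =
      ∑ e ∈ l.divisors, (Nat.totient e : ℝ) * ((if e ∣ d then 1 else 0) * (if e ∣ d' then 1 else 0)) := by
    intro d hd d'
    have hd0 : 0 < d := Nat.pos_of_mem_divisors hd
    conv_lhs => rw [← Nat.sum_totient (Nat.gcd d d')]
    push_cast
    rw [← Finset.sum_subset (s₁ := (Nat.gcd d d').divisors) (s₂ := l.divisors)]
    · apply Finset.sum_congr rfl
      intro e he
      have := Nat.dvd_of_mem_divisors he
      rw [Nat.dvd_gcd_iff] at this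
      simp [this.1, this.2]
    · intro e he
      have := Nat.dvd_of_mem_divisors he
      rw [Nat.mem_divisors]
      exact ⟨(this.trans (Nat.gcd_dvd_left _ _)).trans (Nat.dvd_of_mem_divisors hd), hl.ne'⟩
    · intro e _ he
      rw [Nat.mem_divisors, Nat.dvd_gcd_iff] at he
      have : Nat.gcd d d' ≠ 0 := (Nat.gcd_pos_of_pos_left _ hd0).ne'
      by_cases h1 : e ∣ d <;> by_cases h2 : e ∣ d' <;> simp_all
  calc _ = ∑ d ∈ l.divisors, ∑ d' ∈ l'.divisors, ∑ e ∈ l.divisors,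
        (Nat.totient e : ℝ) * ((if e ∣ d then (moebius (l/d) : ℝ) else 0) * (if e ∣ d' then (moebius (l'/d') : ℝ) else 0)) := by
        apply Finset.sum_congr rfl; intro d hd
        apply Finset.sum_congr rfl; intro d' _
        rw [hg d hd d', Finset.mul_sum]
        apply Finset.sum_congr rfl; intro e _
        split_ifs <;> ring
    _ = ∑ e ∈ l.divisors, (Nat.totient e : ℝ) * ((∑ d ∈ l.divisors, if e ∣ d then (moebius (l/d) : ℝ) else 0) *
          (∑ d' ∈ l'.divisors, if e ∣ d' then (moebius (l'/d') : ℝ) else 0)) := by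
        simp_rw [Finset.sum_mul_sum, Finset.mul_sum]
        rw [Finset.sum_comm (s := l.divisors) (t := l.divisors)]
        apply Finset.sum_congr rfl; intro d _
        rw [Finset.sum_comm]
    _ = _ := by
        simp_rw [aux_moeb l _ hl, aux_moeb l' _ hl']
        rw [Finset.sum_eq_single l]
        · simp
        · intro b _ hb; simp [hb]
        · intro h; simp [hl.ne'] at h

noncomputable def auxC (l n : ℕ) : ℝ :=
  ∑ d ∈ l.divisors, if d ∣ n then (d : ℝ) * (ArithmeticFunction.moebius (l/d) : ℝ) else 0

lemma auxC_coprime (l n : ℕ) (hl : 0 < l) (h : Nat.Coprime l n) :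
    auxC l n = ArithmeticFunction.moebius l := by
  unfold auxC
  rw [Finset.sum_eq_single 1]
  · simp
  · intro d hd hd1
    rw [if_neg]
    intro hdn
    exact hd1 (Nat.eq_one_of_dvd_coprimes h (Nat.dvd_of_mem_divisors hd) hdn)
  · intro h; simp [hl.ne'] at h

lemma aux_moeb_abs (n : ℕ) : |(ArithmeticFunction.moebius n : ℝ)| ≤ 1 := by
  exact_mod_cast ArithmeticFunction.abs_moebius_le_one (n := n)

lemma aux_sigma (l : ℕ) : ∑ d ∈ l.divisors, (d : ℝ) ≤ (l : ℝ)^2 := by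
  calc _ ≤ ∑ d ∈ l.divisors, (l : ℝ) := by
        apply Finset.sum_le_sum; intro d hd
        exact_mod_cast Nat.divisor_le hd
    _ = (#l.divisors : ℝ) * l := by simp
    _ ≤ (l:ℝ) * l := by
        gcongr
        exact_mod_cast Nat.card_divisors_le_self l
    _ = _ := by ring

lemma aux_corr (q l l' a N : ℕ) (hl : 0 < l) (hl' : 0 < l') (h : Nat.Coprime q l)
    (h' : Nat.Coprime q l') :
    |∑ m ∈ Ico a (a+N), auxC l (q*m+1) * auxC l' (q*m+1) -
      N * (if l = l' then (Nat.totient l : ℝ) else 0)| ≤ (l:ℝ)^2 * (l':ℝ)^2 := by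
  rw [← aux_orth l l' hl hl']
  have e1 : ∑ m ∈ Ico a (a+N), auxC l (q*m+1) * auxC l' (q*m+1) =
      ∑ d ∈ l.divisors, ∑ d' ∈ l'.divisors,
        ((d : ℝ) * d' * ((ArithmeticFunction.moebius (l/d) : ℝ) * (ArithmeticFunction.moebius (l'/d') : ℝ))) *
          ((#{m ∈ Ico a (a+N) | Nat.lcm d d' ∣ q*m+1} : ℕ) : ℝ) := by
    unfold auxC
    simp_rw [Finset.sum_mul_sum]
    rw [Finset.sum_comm]
    apply Finset.sum_congr rfl; intro d _
    rw [Finset.sum_comm]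
    apply Finset.sum_congr rfl; intro d' _
    rw [Finset.card_filter]
    push_cast
    rw [Finset.mul_sum]
    apply Finset.sum_congr rfl; intro m _
    by_cases h1 : d ∣ q*m+1 <;> by_cases h2 : d' ∣ q*m+1 <;> simp [h1, h2, Nat.lcm_dvd_iff]
    ring
  rw [e1, Finset.mul_sum, ← Finset.sum_sub_distrib]
  calc _ ≤ ∑ d ∈ l.divisors, ∑ d' ∈ l'.divisors, (d:ℝ) * d' := by
        refine (Finset.abs_sum_le_sum_abs _ _).trans ?_
        apply Finset.sum_le_sum; intro d hd
        rw [Finset.mul_sum, ← Finset.sum_sub_distrib]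
        refine (Finset.abs_sum_le_sum_abs _ _).trans ?_
        apply Finset.sum_le_sum; intro d' hd'
        have hd0 : 0 < d := Nat.pos_of_mem_divisors hd
        have hd0' : 0 < d' := Nat.pos_of_mem_divisors hd'
        have hL : 0 < Nat.lcm d d' := Nat.lcm_pos hd0 hd0'
        have hco : Nat.Coprime q (Nat.lcm d d') := by
          have c1 := Nat.Coprime.coprime_dvd_right (Nat.dvd_of_mem_divisors hd) h
          have c2 := Nat.Coprime.coprime_dvd_right (Nat.dvd_of_mem_divisors hd') h'
          exact Nat.Coprime.coprime_dvd_right (Nat.lcm_dvd_mul d d') (c1.mul_right c2)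
        have hc := aux_cnt q (Nat.lcm d d') a N hco hL
        have hgl : (Nat.gcd d d' : ℝ) * (Nat.lcm d d' : ℝ) = d * d' := by
          exact_mod_cast Nat.gcd_mul_lcm d d'
        have hL' : (Nat.lcm d d' : ℝ) ≠ 0 := by exact_mod_cast hL.ne'
        have hg : (Nat.gcd d d' : ℝ) = d * d' / (Nat.lcm d d' : ℝ) := by
          field_simp; exact hgl
        set μ1 := (ArithmeticFunction.moebius (l/d) : ℝ)
        set μ2 := (ArithmeticFunction.moebius (l'/d') : ℝ)
        set K := ((#{m ∈ Ico a (a+N) | Nat.lcm d d' ∣ q*m+1} : ℕ) : ℝ)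
        have e2 : (d : ℝ) * d' * (μ1 * μ2) * K - N * (μ1 * μ2 * (Nat.gcd d d' : ℝ)) =
            (d * d') * ((μ1 * μ2) * (K - N / (Nat.lcm d d' : ℝ))) := by
          rw [hg]; ring
        rw [e2, abs_mul, abs_mul (μ1 * μ2), abs_mul μ1]
        have m1 : |μ1| ≤ 1 := aux_moeb_abs _
        have m2 : |μ2| ≤ 1 := aux_moeb_abs _
        rw [abs_of_nonneg (by positivity : (0:ℝ) ≤ d * d')]
        have : |μ1| * |μ2| * |K - N / (Nat.lcm d d' : ℝ)| ≤ 1 :=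
          mul_le_one₀ (mul_le_one₀ m1 (abs_nonneg _) m2) (abs_nonneg _) hc
        calc _ ≤ (d:ℝ) * d' * 1 := by gcongr
          _ = _ := by ring
    _ = (∑ d ∈ l.divisors, (d:ℝ)) * ∑ d' ∈ l'.divisors, (d':ℝ) := by
        rw [Finset.sum_mul_sum]
    _ ≤ _ := by
        gcongr
        · exact aux_sigma l
        · exact aux_sigma l'

noncomputable def auxW (D : ℕ) : ℝ :=
  ∑ l ∈ Icc 1 D, (ArithmeticFunction.moebius l : ℝ)^2 / l

lemma aux_sieve (q D a N : ℕ) (hq : q.Prime) (hD : D < q) :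
    (auxW D)^2 * ((#{m ∈ Ico a (a+N) | (q*m+1).Prime ∧ 1 ≤ m} : ℕ) : ℝ) ≤ N * auxW D + (D:ℝ)^4 := by
  set A := {m ∈ Ico a (a+N) | (q*m+1).Prime ∧ 1 ≤ m} with hA
  let w : ℕ → ℝ := fun l => (ArithmeticFunction.moebius l : ℝ) / l
  let G : ℕ → ℝ := fun m => ∑ l ∈ Icc 1 D, w l * auxC l (q*m+1)
  have hcop : ∀ l ∈ Icc 1 D, Nat.Coprime q l := by
    intro l hl
    rw [mem_Icc] at hl
    exact Nat.coprime_of_lt_prime (by omega) (by omega) hq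
  have hG : ∀ m ∈ A, G m = auxW D := by
    intro m hm
    rw [hA, mem_filter] at hm
    apply Finset.sum_congr rfl
    intro l hl
    rw [mem_Icc] at hl
    have : q ≤ q * m := Nat.le_mul_of_pos_right q hm.2.2
    rw [auxC_coprime l _ (by omega) (Nat.coprime_of_lt_prime (by omega) (by omega) hm.2.1).symm]
    simp only [w]; ring
  have h1 : (auxW D)^2 * (#A : ℝ) ≤ ∑ m ∈ Ico a (a+N), (G m)^2 := by
    calc (auxW D)^2 * (#A : ℝ) = ∑ m ∈ A, (G m)^2 := by
          rw [Finset.sum_congr rfl (fun m hm => by rw [hG m hm])]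
          simp; ring
      _ ≤ _ := Finset.sum_le_sum_of_subset_of_nonneg (filter_subset _ _) (fun _ _ _ => sq_nonneg _)
  have h2 : ∑ m ∈ Ico a (a+N), (G m)^2 = ∑ l ∈ Icc 1 D, ∑ l' ∈ Icc 1 D, (w l * w l') *
      ∑ m ∈ Ico a (a+N), auxC l (q*m+1) * auxC l' (q*m+1) := by
    simp only [G, sq, Finset.sum_mul_sum]
    rw [Finset.sum_comm]
    apply Finset.sum_congr rfl; intro l _
    rw [Finset.sum_comm]
    apply Finset.sum_congr rfl; intro l' _
    rw [Finset.mul_sum]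
    apply Finset.sum_congr rfl; intro m _
    ring
  have hw : ∀ l, |w l| ≤ 1 / l := by
    intro l
    simp only [w]
    rw [abs_div, Nat.abs_cast]
    gcongr
    exact aux_moeb_abs l
  have h3 : ∀ l ∈ Icc 1 D, ∀ l' ∈ Icc 1 D, (w l * w l') *
      ∑ m ∈ Ico a (a+N), auxC l (q*m+1) * auxC l' (q*m+1) ≤
      (if l = l' then N * ((ArithmeticFunction.moebius l : ℝ)^2 / l) else 0) + (l:ℝ) * l' := by
    intro l hl l' hl'
    have hc := aux_corr q l l' a N (by rw [mem_Icc] at hl; omega) (by rw [mem_Icc] at hl'; omega)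
      (hcop l hl) (hcop l' hl')
    rw [mem_Icc] at hl hl'
    have hl0 : (0:ℝ) < l := by exact_mod_cast (by omega : 0 < l)
    have hl0' : (0:ℝ) < l' := by exact_mod_cast (by omega : 0 < l')
    set S := ∑ m ∈ Ico a (a+N), auxC l (q*m+1) * auxC l' (q*m+1)
    set T : ℝ := N * (if l = l' then (Nat.totient l : ℝ) else 0) with hT
    have e : w l * w l' * S = w l * w l' * T + w l * w l' * (S - T) := by ring
    rw [e]
    apply add_le_add
    · rw [hT]
      split_ifs with hll
      · subst hll
        have ht : (Nat.totient l : ℝ) ≤ l := by exact_mod_cast Nat.totient_le l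
        simp only [w]
        have : (ArithmeticFunction.moebius l : ℝ) / l * ((ArithmeticFunction.moebius l : ℝ) / l) * (N * (Nat.totient l : ℝ))
          = N * ((ArithmeticFunction.moebius l : ℝ)^2 / l) * ((Nat.totient l : ℝ) / l) := by
          field_simp
        rw [this]
        apply mul_le_of_le_one_right (by positivity)
        rw [div_le_one hl0]; exact ht
      · simp
    · calc _ ≤ |w l * w l' * (S - T)| := le_abs_self _
        _ = |w l| * |w l'| * |S - T| := by rw [abs_mul, abs_mul]
        _ ≤ (1/l) * (1/l') * ((l:ℝ)^2 * (l':ℝ)^2) := by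
            gcongr
            · exact hw l
            · exact hw l'
        _ = _ := by field_simp
  refine h1.trans ?_
  rw [h2]
  calc _ ≤ ∑ l ∈ Icc 1 D, ∑ l' ∈ Icc 1 D,
      ((if l = l' then N * ((ArithmeticFunction.moebius l : ℝ)^2 / l) else 0) + (l:ℝ) * l') :=
        Finset.sum_le_sum fun l hl => Finset.sum_le_sum fun l' hl' => h3 l hl l' hl'
    _ = N * auxW D + (∑ l ∈ Icc 1 D, (l:ℝ)) * (∑ l ∈ Icc 1 D, (l:ℝ)) := by
        simp_rw [Finset.sum_add_distrib, Finset.sum_mul_sum]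
        congr 1
        unfold auxW
        rw [Finset.mul_sum]
        apply Finset.sum_congr rfl; intro l hl
        rw [Finset.sum_ite_eq, if_pos hl]
    _ ≤ N * auxW D + (D:ℝ)^2 * (D:ℝ)^2 := by
        have : ∑ l ∈ Icc 1 D, (l:ℝ) ≤ (D:ℝ)^2 := by
          calc _ ≤ ∑ l ∈ Icc 1 D, (D:ℝ) := by
                apply Finset.sum_le_sum; intro l hl
                rw [mem_Icc] at hl
                exact_mod_cast hl.2
            _ = _ := by simp; ring
        gcongr
    _ = _ := by ring

lemma auxW_lower (D : ℕ) : Real.log (D+1) ≤ 2 * auxW D := by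
  have h0 := log_add_one_le_harmonic D
  rw [harmonic_eq_sum_Icc] at h0
  push_cast at h0
  refine h0.trans ?_
  choose f g hfg hsf using Nat.sq_mul_squarefree
  have hz : ∑ b ∈ Icc 1 D, ((b:ℝ)^2)⁻¹ ≤ 2 := by
    rcases Nat.eq_zero_or_pos D with h | h
    · subst h; simp
    · rw [← Finset.add_sum_Ioc_eq_sum_Icc h]
      have := sum_Ioc_inv_sq_le_sub (α := ℝ) one_ne_zero h
      have h9 : (0:ℝ) ≤ (D:ℝ)⁻¹ := by positivity
      norm_num at this ⊢
      linarith
  have hinj : Set.InjOn (fun n => (f n, g n)) (Icc 1 D : Finset ℕ) := by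
    intro x _ y _ h
    simp only [Prod.mk.injEq] at h
    rw [← hfg x, ← hfg y, h.1, h.2]
  calc ∑ n ∈ Icc 1 D, (n:ℝ)⁻¹ = ∑ n ∈ Icc 1 D,
        (fun p : ℕ × ℕ => (ArithmeticFunction.moebius p.1 : ℝ)^2 / p.1 * ((p.2:ℝ)^2)⁻¹) (f n, g n) := by
        apply Finset.sum_congr rfl; intro n _
        have h1 : ((ArithmeticFunction.moebius (f n) : ℤ) : ℝ)^2 = 1 := by
          exact_mod_cast ArithmeticFunction.moebius_sq_eq_one_of_squarefree (hsf n)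
        simp only [h1]
        conv_lhs => rw [← hfg n]
        push_cast
        rw [mul_inv]; ring
    _ = ∑ p ∈ (Icc 1 D).image (fun n => (f n, g n)),
        (ArithmeticFunction.moebius p.1 : ℝ)^2 / p.1 * ((p.2:ℝ)^2)⁻¹ := by
        rw [Finset.sum_image hinj]
    _ ≤ ∑ p ∈ Icc 1 D ×ˢ Icc 1 D, (ArithmeticFunction.moebius p.1 : ℝ)^2 / p.1 * ((p.2:ℝ)^2)⁻¹ := by
        apply Finset.sum_le_sum_of_subset_of_nonneg
        · intro p hp
          rw [mem_image] at hp
          obtain ⟨n, hn, rfl⟩ := hp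
          rw [mem_Icc] at hn
          have h2 := hfg n
          have hf : 0 < f n := Nat.pos_of_ne_zero (by intro h; rw [h] at h2; simp at h2; omega)
          have hg : 0 < g n := Nat.pos_of_ne_zero (by intro h; rw [h] at h2; simp at h2; omega)
          simp only [mem_product, mem_Icc]
          have : f n ≤ n := by nlinarith [pow_pos hg 2]
          have : g n ≤ n := by nlinarith
          omega
        · intros; positivity
    _ = auxW D * ∑ b ∈ Icc 1 D, ((b:ℝ)^2)⁻¹ := by
        unfold auxW
        rw [Finset.sum_mul_sum, Finset.sum_product]
    _ ≤ auxW D * 2 := by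
        gcongr
        unfold auxW; positivity
    _ = _ := by ring

lemma aux_block (q k : ℕ) (hq : q.Prime) (h3 : 3 ≤ q)
    (hk : (q:ℝ) / (16 * (Real.log q)^2) ≤ 2^k) :
    ∑ m ∈ Ico (2^k) (2^k + 2^k) with (q*m+1).Prime ∧ 1 ≤ m, (1:ℝ) / ((q * m + 1 : ℕ) : ℝ) ≤
      8208 / (q * Real.log q) := by
  have hq3 : (3:ℝ) ≤ q := by exact_mod_cast h3
  have hq0 : (0:ℝ) < q := by linarith
  have hL0 : 0 < Real.log q := Real.log_pos (by linarith)
  set L := Real.log q with hL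
  set x : ℝ := (q:ℝ)^(1/8:ℝ) with hx
  have hx0 : 0 ≤ x := by positivity
  have hx4 : x^4 = Real.sqrt q := by
    rw [hx, ← Real.rpow_natCast, ← Real.rpow_mul hq0.le, Real.sqrt_eq_rpow]; norm_num
  have hlogx : Real.log x = L / 8 := by
    rw [hx, Real.log_rpow hq0]; ring
  have hx1 : 1 < x := Real.one_lt_rpow (by linarith) (by norm_num)
  have hxq : x < q := by
    calc x < (q:ℝ)^(1:ℝ) := Real.rpow_lt_rpow_of_exponent_lt (by linarith) (by norm_num)
      _ = q := Real.rpow_one _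
  set D := ⌊x⌋₊ with hD
  have hDx : (D:ℝ) ≤ x := Nat.floor_le hx0
  have hDq : D < q := by exact_mod_cast hDx.trans_lt hxq
  have hW : L / 16 ≤ auxW D := by
    have h1 := auxW_lower D
    have h2 : Real.log x ≤ Real.log (D+1) :=
      Real.log_le_log (by linarith) (Nat.lt_floor_add_one x).le
    rw [hlogx] at h2
    linarith
  have hs := aux_sieve q D (2^k) (2^k) hq hDq
  set A := {m ∈ Ico (2^k) (2^k + 2^k) | (q*m+1).Prime ∧ 1 ≤ m} with hA
  set W := auxW D
  have hW0 : 0 < W := lt_of_lt_of_le (by positivity) hW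
  push_cast at hs
  have hD4 : (D:ℝ)^4 ≤ Real.sqrt q := by
    rw [← hx4]; gcongr
  have hs0 : 0 < Real.sqrt q := Real.sqrt_pos.mpr hq0
  have hss : Real.sqrt q * Real.sqrt q = q := Real.mul_self_sqrt hq0.le
  have hLs : L ≤ 2 * Real.sqrt q := by
    have h1 : Real.log (Real.sqrt q) = L / 2 := by rw [Real.log_sqrt hq0.le]
    have h2 := Real.log_le_sub_one_of_pos hs0
    linarith
  have hB : Real.sqrt q ≤ 32 * 2^k * L := by
    rw [div_le_iff₀ (by positivity)] at hk
    have h1 : Real.sqrt q * L ≤ 2 * q := by nlinarith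
    have h2 : Real.sqrt q * L ≤ (32 * 2^k * L) * L := by nlinarith
    exact le_of_mul_le_mul_right h2 hL0
  have hAcard : (#A : ℝ) ≤ 8208 * 2^k / L := by
    rw [le_div_iff₀ hL0]
    have h1 : W * (W * #A) ≤ W * (2^k + 512 * 2^k) := by
      have : Real.sqrt q ≤ W * (512 * 2^k) := by
        have : (0:ℝ) < 2^k := by positivity
        nlinarith
      nlinarith
    have h2 := le_of_mul_le_mul_left h1 hW0
    have h3 : (L/16) * #A ≤ W * #A := by gcongr
    linarith
  calc _ ≤ ∑ m ∈ A, (1:ℝ) / (q * 2^k) := by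
        apply Finset.sum_le_sum
        intro m hm
        rw [hA, mem_filter, mem_Ico] at hm
        have : (2:ℝ)^k ≤ m := by exact_mod_cast hm.1.1
        push_cast
        apply one_div_le_one_div_of_le (by positivity)
        nlinarith
    _ = #A * (1 / (q * 2^k)) := by simp
    _ ≤ (8208 * 2^k / L) * (1 / (q * 2^k)) := by gcongr
    _ = _ := by field_simp

noncomputable def auxM (q : ℕ) : Finset ℕ :=
  {m ∈ Icc 1 ⌊(q:ℝ) * (Real.log q)^4⌋₊ | (q*m+1).Prime ∧ (q:ℝ) / (8 * (Real.log q)^2) < m}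

lemma auxM_sum (q : ℕ) (hq : q.Prime) (h3 : 3 ≤ q) :
    ∑ m ∈ auxM q, (1:ℝ) / ((q * m + 1 : ℕ) : ℝ) ≤
      114912 * Real.log (Real.log ((q:ℝ) + 16)) / (q * Real.log q) := by
  have hq3 : (3:ℝ) ≤ q := by exact_mod_cast h3
  have hq0 : (0:ℝ) < q := by linarith
  have hL1 : 1 < Real.log q := by
    rw [Real.lt_log_iff_exp_lt hq0]
    linarith [Real.exp_one_lt_d9]
  have hLL : Real.log (Real.log q) ≤ Real.log (Real.log ((q:ℝ) + 16)) := by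
    apply Real.log_le_log (by linarith)
    exact Real.log_le_log hq0 (by linarith)
  have hLL1 : 1 ≤ Real.log (Real.log ((q:ℝ) + 16)) := by
    have h16 : Real.log 16 ≤ Real.log ((q:ℝ)+16) := Real.log_le_log (by norm_num) (by linarith)
    have h16' : Real.log 16 = 4 * Real.log 2 := by
      rw [show (16:ℝ) = 2^4 by norm_num, Real.log_pow]; norm_num
    have := Real.log_two_gt_d9
    have := Real.exp_one_lt_d9
    rw [Real.le_log_iff_exp_le (by linarith)]
    linarith
  set LL := Real.log (Real.log ((q:ℝ) + 16))
  set L := Real.log q with hL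
  set U : ℝ := (q:ℝ) * L^4 with hU
  set V : ℝ := (q:ℝ) / (8 * L^2) with hV
  have hL0 : 0 < L := by linarith
  have hV0 : 0 < V := by positivity
  have hU1 : 1 ≤ U := by
    have : 1 ≤ L^4 := one_le_pow₀ hL1.le
    nlinarith
  set k0 := Nat.log 2 ⌊V⌋₊ with hk0
  set k1 := Nat.log 2 ⌊U⌋₊ with hk1
  have hVk : V < 2^(k0+1) := by
    have h1 : ⌊V⌋₊ < 2^(k0+1) := Nat.lt_pow_succ_log_self (by norm_num) _
    exact_mod_cast (Nat.floor_lt hV0.le).mp h1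
  have hUk : (2:ℝ)^k1 ≤ U := by
    have h0 : ⌊U⌋₊ ≠ 0 := (Nat.floor_pos.mpr hU1).ne'
    have h1 : 2^k1 ≤ ⌊U⌋₊ := Nat.pow_log_le_self 2 h0
    have := (Nat.le_floor_iff (by linarith)).mp h1
    exact_mod_cast this
  have hmaps : ∀ m ∈ auxM q, Nat.log 2 m ∈ Icc k0 k1 := by
    intro m hm
    unfold auxM at hm
    rw [mem_filter, mem_Icc] at hm
    rw [mem_Icc]
    refine ⟨Nat.log_mono_right ?_, Nat.log_mono_right hm.1.2⟩
    have := hm.2.2.le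
    exact_mod_cast (Nat.floor_le hV0.le).trans this
  have hcard : (#(Icc k0 k1) : ℝ) ≤ 14 * LL := by
    rw [Nat.card_Icc]
    by_cases hc : k0 ≤ k1 + 1
    · rw [Nat.cast_sub hc]
      push_cast
      have h1 : (k1:ℝ) * Real.log 2 ≤ Real.log U := by
        rw [← Real.log_pow]; exact Real.log_le_log (by positivity) hUk
      have h2 : Real.log V ≤ ((k0:ℝ)+1) * Real.log 2 := by
        have := Real.log_le_log hV0 hVk.le
        rw [Real.log_pow] at this
        exact_mod_cast this
      have h3 : Real.log U = Real.log q + 4 * Real.log L := by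
        rw [hU, Real.log_mul (by positivity) (by positivity), Real.log_pow]; norm_num
      have h4 : Real.log V = Real.log q - (3 * Real.log 2 + 2 * Real.log L) := by
        rw [hV, Real.log_div (by positivity) (by positivity),
          Real.log_mul (by positivity) (by positivity), Real.log_pow,
          show (8:ℝ) = 2^3 by norm_num, Real.log_pow]
        norm_num
      have h5 := Real.log_two_gt_d9
      have h6 : ((k1:ℝ) + 1 - k0) * Real.log 2 ≤ 5 * Real.log 2 + 6 * Real.log L := by linarith
      have h7 : 5 * Real.log 2 + 6 * Real.log L ≤ (14 * LL) * Real.log 2 := by nlinarith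
      exact le_of_mul_le_mul_right (h6.trans h7) (by linarith)
    · rw [Nat.sub_eq_zero_of_le (by omega)]
      push_cast; linarith
  rw [← Finset.sum_fiberwise_of_maps_to hmaps]
  calc _ ≤ ∑ k ∈ Icc k0 k1, (8208:ℝ) / (q * L) := by
        apply Finset.sum_le_sum
        intro k hk
        rw [mem_Icc] at hk
        refine le_trans ?_ (aux_block q k hq h3 ?_)
        · apply Finset.sum_le_sum_of_subset_of_nonneg
          · intro m hm
            unfold auxM at hm
            simp only [mem_filter, mem_Icc, mem_Ico] at hm ⊢
            obtain ⟨⟨⟨h1, _⟩, hp, _⟩, rfl⟩ := hm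
            refine ⟨⟨Nat.pow_log_le_self 2 (by omega), ?_⟩, hp, h1⟩
            have := Nat.lt_pow_succ_log_self (b := 2) (by norm_num) m
            rw [pow_succ] at this
            omega
          · intros; positivity
        · have h1 : (2:ℝ)^k0 ≤ 2^k := pow_le_pow_right₀ (by norm_num) hk.1
          have h2 : (q:ℝ) / (16 * L^2) = V / 2 := by rw [hV]; field_simp; norm_num
          rw [← hL, h2]
          rw [pow_succ] at hVk
          linarith
    _ = #(Icc k0 k1) * ((8208:ℝ) / (q * L)) := by simp
    _ ≤ (14 * LL) * ((8208:ℝ) / (q * L)) := by gcongr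
    _ = _ := by ring

theorem stmt3 :
    ∃ C : ℝ, ∀ X : ℝ, 1 ≤ X → ∀ q : ℕ, q.Prime → 3 ≤ q →
      (Nat.card {n : ℕ | 0 < n ∧ (n : ℝ) ≤ X ∧ ∃ r : ℕ, r.Prime ∧ r ∣ n ∧
          r % q = 1 ∧ (q : ℝ) ^ 2 / (4 * (Real.log q) ^ 2) < (r : ℝ) ∧
          (r : ℝ) ≤ (q : ℝ) ^ 2 * (Real.log q) ^ 4} : ℝ) ≤
        C * X * Real.log (Real.log ((q : ℝ) + 16)) / (q * Real.log q) := by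
  refine ⟨114912, ?_⟩
  intro X hX q hq h3
  have hq3 : (3:ℝ) ≤ q := by exact_mod_cast h3
  have hq0 : (0:ℝ) < q := by linarith
  have hL0 : 0 < Real.log q := Real.log_pos (by linarith)
  set T : Finset ℕ := (auxM q).biUnion (fun m => {n ∈ Ioc 0 ⌊X⌋₊ | (q*m+1) ∣ n}) with hT
  have hsub : {n : ℕ | 0 < n ∧ (n : ℝ) ≤ X ∧ ∃ r : ℕ, r.Prime ∧ r ∣ n ∧
          r % q = 1 ∧ (q : ℝ) ^ 2 / (4 * (Real.log q) ^ 2) < (r : ℝ) ∧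
          (r : ℝ) ≤ (q : ℝ) ^ 2 * (Real.log q) ^ 4} ⊆ (T : Set ℕ) := by
    rintro n ⟨hn0, hnX, r, hr, hrn, hrq, hlo, hhi⟩
    have hr' : q * (r / q) + 1 = r := by
      have := Nat.div_add_mod r q
      omega
    set m := r / q with hm
    have hm1 : 1 ≤ m := by
      rcases Nat.eq_zero_or_pos m with h | h
      · rw [h] at hr'
        simp at hr'
        exact absurd hr'.symm hr.one_lt.ne'
      · exact h
    have hm1' : (1:ℝ) ≤ m := by exact_mod_cast hm1
    have hrR : (q:ℝ) * m + 1 = r := by exact_mod_cast hr'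
    simp only [hT, coe_biUnion, Set.mem_iUnion, mem_coe, mem_filter, mem_Ioc]
    refine ⟨m, ?_, ⟨hn0, Nat.le_floor hnX⟩, by rw [hr']; exact hrn⟩
    unfold auxM
    rw [mem_filter, mem_Icc]
    refine ⟨⟨hm1, Nat.le_floor ?_⟩, by rw [hr']; exact hr, ?_⟩
    · have : (q:ℝ) * m ≤ q * (q * (Real.log q)^4) := by nlinarith
      exact le_of_mul_le_mul_left this hq0
    · rw [div_lt_iff₀ (by positivity)] at hlo ⊢
      rw [← hrR] at hlo
      have h1 : (q:ℝ) * m + 1 ≤ 2 * (q * m) := by nlinarith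
      have h2 : (q:ℝ) * q < q * (m * (8 * (Real.log q)^2)) := by
        have : ((q:ℝ) * m + 1) * (4 * (Real.log q)^2) ≤ 2 * (q * m) * (4 * (Real.log q)^2) := by
          gcongr
        nlinarith
      exact lt_of_mul_lt_mul_left h2 hq0.le
  have hcard : Nat.card {n : ℕ | 0 < n ∧ (n : ℝ) ≤ X ∧ ∃ r : ℕ, r.Prime ∧ r ∣ n ∧
          r % q = 1 ∧ (q : ℝ) ^ 2 / (4 * (Real.log q) ^ 2) < (r : ℝ) ∧
          (r : ℝ) ≤ (q : ℝ) ^ 2 * (Real.log q) ^ 4} ≤ #T := by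
    have := Nat.card_mono T.finite_toSet hsub
    simpa using this
  calc _ ≤ (#T : ℝ) := by exact_mod_cast hcard
    _ ≤ ∑ m ∈ auxM q, ((#{n ∈ Ioc 0 ⌊X⌋₊ | (q*m+1) ∣ n} : ℕ) : ℝ) := by
        exact_mod_cast Finset.card_biUnion_le
    _ ≤ ∑ m ∈ auxM q, X * ((1:ℝ) / ((q * m + 1 : ℕ) : ℝ)) := by
        apply Finset.sum_le_sum
        intro m _
        rw [Nat.Ioc_filter_dvd_card_eq_div]
        calc ((⌊X⌋₊ / (q*m+1) : ℕ) : ℝ) ≤ (⌊X⌋₊ : ℝ) / ((q*m+1 : ℕ) : ℝ) := Nat.cast_div_le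
          _ ≤ X / ((q*m+1 : ℕ) : ℝ) := by
              gcongr
              exact Nat.floor_le (by linarith)
          _ = _ := by ring
    _ = X * ∑ m ∈ auxM q, ((1:ℝ) / ((q * m + 1 : ℕ) : ℝ)) := by rw [Finset.mul_sum]
    _ ≤ X * (114912 * Real.log (Real.log ((q:ℝ) + 16)) / (q * Real.log q)) := by
        gcongr
        exact auxM_sum q hq h3
    _ = _ := by ring
end

section
/- Let a > 1 be an integer. Assume the following (GRH-conditional) counting bound of Li–Pomerance: there is a constant C such that for every odd prime q such that a is not a qth power, and every real X ≥ 3, the number of positive integers n ≤ X divisible by some prime r ∈ A_q with r ≥ q²(log q)⁴ is at most C·(X/(q log q) + X·log log X/q²). Then there is a constant C' (depending only on a) such that for all sufficiently large X and every real z with log log X ≤ z ≤ X^(1/2), the number of positive integers n ≤ X with P(λ(n)/ℓ*_a(n)) ≥ z is at most C'·X·log log z/log z. -/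
open Filter

/-- Carmichael's function: the exponent of the multiplicative group `(ℤ/nℤ)ˣ`. -/
noncomputable def carmichael (n : ℕ) : ℕ :=
  Monoid.exponent (ZMod n)ˣ

/-- `P(n)`: the largest prime factor of `n`, with `P(1) = 1`. -/
def largestPrimeFactor (n : ℕ) : ℕ :=
  max 1 (n.primeFactors.sup id)


lemma coprimePart_spec (a n : ℕ) (hn : 0 < n) :
    coprimePart a n ∣ n ∧ Nat.Coprime (coprimePart a n) a := by
  have hne : (n.divisors.filter fun d => Nat.Coprime d a).Nonempty :=
    ⟨1, by simp [hn.ne']⟩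
  obtain ⟨d, hd, he⟩ := Finset.exists_mem_eq_sup _ hne (id : ℕ → ℕ)
  have : coprimePart a n = d := he
  rw [this]
  simp only [Finset.mem_filter, Nat.mem_divisors] at hd
  exact ⟨hd.1.1, hd.2⟩

lemma prime_dvd_coprimePart (a n r : ℕ) (hn : 0 < n) (hr : r.Prime) (hrn : r ∣ n)
    (hra : ¬ r ∣ a) : r ∣ coprimePart a n := by
  obtain ⟨h1, h2⟩ := coprimePart_spec a n hn
  by_contra hc
  have hcop : Nat.Coprime r (coprimePart a n) := (Nat.Prime.coprime_iff_not_dvd hr).2 hc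
  have hra' : Nat.Coprime r a := (Nat.Prime.coprime_iff_not_dvd hr).2 hra
  have hmem : r * coprimePart a n ∈ (n.divisors.filter fun d => Nat.Coprime d a) := by
    simp only [Finset.mem_filter, Nat.mem_divisors]
    exact ⟨⟨hcop.mul_dvd_of_dvd_of_dvd hrn h1, hn.ne'⟩, Nat.Coprime.mul_left hra' h2⟩
  have hle : r * coprimePart a n ≤ coprimePart a n :=
    Finset.le_sup (f := (id : ℕ → ℕ)) hmem
  have hpos : 0 < coprimePart a n := Nat.pos_of_dvd_of_pos h1 hn
  have := hr.two_le
  nlinarith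

lemma lstar_dvd_carmichael (a n : ℕ) (hn : 0 < n) : lstar a n ∣ carmichael n := by
  obtain ⟨h1, h2⟩ := coprimePart_spec a n hn
  have hpos : 0 < coprimePart a n := Nat.pos_of_dvd_of_pos h1 hn
  have e1 : carmichael n = ArithmeticFunction.carmichael n :=
    (ArithmeticFunction.carmichael_eq_exponent hn.ne').symm
  rw [e1]
  refine dvd_trans ?_ (ArithmeticFunction.carmichael_dvd h1)
  have : lstar a n = orderOf (ZMod.unitOfCoprime a h2.symm) := by
    unfold lstar
    rw [← orderOf_units, ZMod.coe_unitOfCoprime]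
  rw [this, ArithmeticFunction.carmichael_eq_exponent hpos.ne']
  exact Monoid.order_dvd_exponent _

lemma orderOf_dvd_lstar (a n r : ℕ) (h : r ∣ coprimePart a n) :
    orderOf (a : ZMod r) ∣ lstar a n := by
  have := orderOf_map_dvd (ZMod.castHom h (ZMod r) : ZMod (coprimePart a n) →* ZMod r)
    (a : ZMod (coprimePart a n))
  simpa [lstar] using this

lemma alg_key (a n q : ℕ) (ha : 1 < a) (hn : 0 < n) (hq : q.Prime) (hqa : a < q)
    (hdvd : q ∣ carmichael n / lstar a n) :
    q ^ 2 ∣ n ∨ ∃ r : ℕ, r.Prime ∧ r ∣ n ∧ r % q = 1 ∧ (a : ZMod r) ^ ((r - 1) / q) = 1 := by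
  by_contra hcon
  push Not at hcon
  obtain ⟨hq2, hr⟩ := hcon
  have hl := lstar_dvd_carmichael a n hn
  have hc0 : carmichael n ≠ 0 := by
    have : NeZero n := ⟨hn.ne'⟩
    exact Monoid.exponent_ne_zero_of_finite
  obtain ⟨t, ht⟩ := hdvd
  have hc : carmichael n = q * (lstar a n * t) := by
    have := Nat.div_mul_cancel hl
    rw [ht] at this
    rw [← this]; ring
  set m := lstar a n * t with hm
  have hm0 : m ≠ 0 := by
    intro h; rw [h] at hc; simp at hc; exact hc0 hc
  have e1 : carmichael n = ArithmeticFunction.carmichael n :=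
    (ArithmeticFunction.carmichael_eq_exponent hn.ne').symm
  have : NeZero n := ⟨hn.ne'⟩
  have key : carmichael n ∣ m := by
    rw [e1, ArithmeticFunction.carmichael_factorization, Finset.lcm_dvd_iff]
    intro p hp
    have hpp : p.Prime := Nat.prime_of_mem_primeFactors hp
    have hpn : p ∣ n := Nat.dvd_of_mem_primeFactors hp
    set k := n.factorization p with hk
    have hk1 : 1 ≤ k := (hpp.dvd_iff_one_le_factorization hn.ne').1 hpn
    have hEl : ArithmeticFunction.carmichael (p ^ k) ∣ q * m := by
      rw [← hc, e1]
      exact ArithmeticFunction.carmichael_dvd (Nat.ordProj_dvd n p)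
    have hEt : ArithmeticFunction.carmichael (p ^ k) ∣ p ^ (k - 1) * (p - 1) := by
      have := ArithmeticFunction.carmichael_dvd_totient (p ^ k)
      rwa [Nat.totient_prime_pow hpp hk1] at this
    set E := ArithmeticFunction.carmichael (p ^ k) with hE
    have hpp1 := hpp.two_le
    by_cases hpq : p = q
    · have hk2 : k = 1 := by
        by_contra hne
        have h2 : 2 ≤ k := by omega
        exact hq2 ((hpq ▸ pow_dvd_pow p h2).trans (hpq ▸ Nat.ordProj_dvd n p))
      rw [hk2] at hEt
      simp at hEt
      have hcop : Nat.Coprime E q := by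
        refine Nat.Coprime.coprime_dvd_left hEt ?_
        rw [← hpq]
        exact (Nat.coprime_self_sub_left (by omega)).2 (by simp)
      exact hcop.dvd_of_dvd_mul_left hEl
    · have hcpq : Nat.Coprime p q := (Nat.coprime_primes hpp hq).2 hpq
      by_cases hdv : q ∣ p - 1
      · have hpq1 : q < p := by
          have := Nat.le_of_dvd (by omega) hdv
          omega
        have hpa : ¬ p ∣ a := fun h => by
          have := Nat.le_of_dvd (by omega) h
          omega
        have hmod : p % q = 1 := by
          obtain ⟨s, hs⟩ := hdv
          have : p = 1 + q * s := by omega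
          rw [this, Nat.add_mul_mod_self_left, Nat.mod_eq_of_lt hq.one_lt]
        have hne := hr p hpp hpn hmod
        have hord := orderOf_dvd_lstar a n p (prime_dvd_coprimePart a n p hn hpp hpn hpa)
        have : Fact p.Prime := ⟨hpp⟩
        have ha0 : (a : ZMod p) ≠ 0 := by
          rwa [Ne, ZMod.natCast_eq_zero_iff]
        have hord1 : orderOf (a : ZMod p) ∣ p - 1 :=
          orderOf_dvd_of_pow_eq_one (ZMod.pow_card_sub_one_eq_one ha0)
        have hord2 : ¬ orderOf (a : ZMod p) ∣ (p - 1) / q := fun h =>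
          hne (orderOf_dvd_iff_pow_eq_one.1 h)
        have hp10 : p - 1 ≠ 0 := by omega
        have ho0 : orderOf (a : ZMod p) ≠ 0 := fun h => by
          rw [h] at hord1; exact hp10 (Nat.eq_zero_of_zero_dvd hord1)
        have hE0 : E ≠ 0 := fun h => by
          rw [h] at hEl
          exact (mul_ne_zero hq.ne_zero hm0) (Nat.eq_zero_of_zero_dvd hEl)
        have hfac : (p - 1).factorization q ≤ (orderOf (a : ZMod p)).factorization q := by
          by_contra hlt
          push Not at hlt
          apply hord2
          have hd0 : (p - 1) / q ≠ 0 := by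
            have := Nat.div_pos (Nat.le_of_dvd (by omega) hdv) hq.pos
            omega
          rw [← Nat.factorization_le_iff_dvd ho0 hd0, Nat.factorization_div hdv]
          intro s
          have hs := (Nat.factorization_le_iff_dvd ho0 hp10).2 hord1 s
          simp only [Finsupp.coe_tsub, Pi.sub_apply]
          by_cases hsq : s = q
          · subst hsq
            rw [hq.factorization_self]; omega
          · rw [hq.factorization]
            rw [Finsupp.single_eq_of_ne hsq]; omega
        rw [← Nat.factorization_le_iff_dvd hE0 hm0]
        intro s
        by_cases hsq : s = q
        · subst hsq
          have h1 := (Nat.factorization_le_iff_dvd hE0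
            (mul_ne_zero (pow_ne_zero _ hpp.ne_zero) hp10)).2 hEt s
          rw [Nat.factorization_mul (pow_ne_zero _ hpp.ne_zero) hp10, Nat.factorization_pow,
            hpp.factorization] at h1
          simp only [Finsupp.coe_add, Pi.add_apply, Finsupp.smul_single, Finsupp.single_eq_of_ne (Ne.symm hpq), zero_add] at h1
          have h2 := (Nat.factorization_le_iff_dvd ho0 hm0).2 (hord.trans (Dvd.intro _ rfl)) s
          omega
        · have h1 := (Nat.factorization_le_iff_dvd hE0 (mul_ne_zero hq.ne_zero hm0)).2 hEl s
          rw [Nat.factorization_mul hq.ne_zero hm0, hq.factorization] at h1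
          simpa [Finsupp.single_eq_of_ne hsq] using h1
      · have hcop : Nat.Coprime E q := by
          refine Nat.Coprime.coprime_dvd_left hEt ?_
          exact Nat.Coprime.mul_left (Nat.Coprime.pow_left _ hcpq)
            ((Nat.Prime.coprime_iff_not_dvd hq).2 hdv).symm
        exact hcop.dvd_of_dvd_mul_left hEl
  have hle := Nat.le_of_dvd (Nat.pos_of_ne_zero hm0) key
  have := hq.two_le
  have hmp := Nat.pos_of_ne_zero hm0
  rw [hc] at hle
  nlinarith

/-! ### The Selberg sieve for `q m + 1` -/

/-- The normalising sum in the sieve. -/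
noncomputable def sieveS (D : ℕ) : ℝ :=
  ∑ k ∈ Finset.Icc 1 D, ((ArithmeticFunction.moebius k : ℤ) : ℝ) ^ 2 / (Nat.totient k : ℝ)

lemma sieveS_lower (D : ℕ) : Real.log D / 2 ≤ sieveS D := by
  classical
  set T : ℝ := ∑ k ∈ (Finset.Icc 1 D).filter Squarefree, (1 : ℝ) / k with hT
  have h1 : T ≤ sieveS D := by
    rw [hT, Finset.sum_filter]
    apply Finset.sum_le_sum
    intro k hk
    rw [Finset.mem_Icc] at hk
    have hpos : (0 : ℝ) < Nat.totient k := by exact_mod_cast Nat.totient_pos.2 (by omega)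
    split_ifs with hs
    · have : ((ArithmeticFunction.moebius k : ℤ) : ℝ) ^ 2 = 1 := by
        exact_mod_cast ArithmeticFunction.moebius_sq_eq_one_of_squarefree hs
      rw [this]
      apply one_div_le_one_div_of_le hpos
      exact_mod_cast Nat.totient_le k
    · positivity
  have hT0 : 0 ≤ T := Finset.sum_nonneg fun k _ => by positivity
  have h2 : ∑ m ∈ Finset.Icc 1 D, (1 : ℝ) / (m : ℝ) ^ 2 ≤ 2 := by
    have := sum_Ioo_inv_sq_le (α := ℝ) 0 (D + 1)
    have he : Finset.Ioo 0 (D + 1) = Finset.Icc 1 D := by ext; simp; omega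
    rw [he] at this
    simpa using this
  have h3 : ∑ n ∈ Finset.Icc 1 D, (1 : ℝ) / n ≤
      T * ∑ m ∈ Finset.Icc 1 D, (1 : ℝ) / (m : ℝ) ^ 2 := by
    rw [hT, Finset.sum_mul_sum, ← Finset.sum_product']
    choose f g hfg hsq using Nat.sq_mul_squarefree
    have e : ∑ n ∈ Finset.Icc 1 D, (1 : ℝ) / n =
        ∑ x ∈ (Finset.Icc 1 D).image (fun n => (f n, g n)), (1 / (x.1 : ℝ)) * (1 / (x.2 : ℝ) ^ 2) := by
      rw [Finset.sum_image]
      · refine Finset.sum_congr rfl fun n _ => ?_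
        have : (n : ℝ) = (g n : ℝ) ^ 2 * f n := by exact_mod_cast (hfg n).symm
        simp only
        rw [this, div_mul_div_comm, one_mul, mul_comm]
      · intro x _ y _ hxy
        simp only [Prod.mk.injEq] at hxy
        rw [← hfg x, ← hfg y, hxy.1, hxy.2]
    rw [e]
    apply Finset.sum_le_sum_of_subset_of_nonneg
    · intro x hx
      simp only [Finset.mem_image, Finset.mem_Icc] at hx
      obtain ⟨n, hn, rfl⟩ := hx
      have h := hfg n
      have hf0 : 0 < f n := Nat.pos_of_ne_zero fun h0 => by rw [h0] at h; omega
      have hg0 : 0 < g n := Nat.pos_of_ne_zero fun h0 => by rw [h0] at h; simp at h; omega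
      simp only [Finset.mem_product, Finset.mem_filter, Finset.mem_Icc]
      refine ⟨⟨⟨hf0, ?_⟩, hsq n⟩, hg0, ?_⟩
      · have := Nat.le_of_dvd hn.1 (Dvd.intro_left _ h)
        omega
      · have := Nat.le_of_dvd hn.1 ((dvd_pow_self (g n) two_ne_zero).trans (Dvd.intro _ h))
        omega
    · intro x _ _
      positivity
  have h4 : Real.log D ≤ ∑ n ∈ Finset.Icc 1 D, (1 : ℝ) / n := by
    have := log_add_one_le_harmonic D
    rw [harmonic_eq_sum_Icc] at this
    push_cast at this
    rcases Nat.eq_zero_or_pos D with h0 | h0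
    · subst h0; simp
    · have h5 : Real.log D ≤ Real.log (D + 1) :=
        Real.log_le_log (by exact_mod_cast h0) (by linarith)
      simpa using h5.trans this
  nlinarith

lemma sieveS_pos (D : ℕ) (hD : 1 ≤ D) : 0 < sieveS D := by
  unfold sieveS
  refine Finset.sum_pos' (fun k _ => by positivity) ⟨1, by simp [hD], by simp⟩

noncomputable def sieveY (D k : ℕ) : ℝ :=
  ((ArithmeticFunction.moebius k : ℤ) : ℝ) / (Nat.totient k * sieveS D)

/-- The weights `λ_d / d`. -/
noncomputable def sieveW (D d : ℕ) : ℝ :=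
  ∑ k ∈ Finset.Icc 1 D, if d ∣ k then ((ArithmeticFunction.moebius (k / d) : ℤ) : ℝ) * sieveY D k else 0

lemma abs_moebius_sq (k : ℕ) : |((ArithmeticFunction.moebius k : ℤ) : ℝ)| =
    ((ArithmeticFunction.moebius k : ℤ) : ℝ) ^ 2 := by
  rcases ArithmeticFunction.moebius_eq_or k with h | h | h <;> simp [h]

lemma sieveW_abs (D d : ℕ) (hD : 1 ≤ D) : |sieveW D d| ≤ 1 := by
  have hS := sieveS_pos D hD
  calc |sieveW D d| ≤ ∑ k ∈ Finset.Icc 1 D, |if d ∣ k then ((ArithmeticFunction.moebius (k / d) : ℤ) : ℝ) * sieveY D k else 0| :=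
        Finset.abs_sum_le_sum_abs _ _
    _ ≤ ∑ k ∈ Finset.Icc 1 D, (((ArithmeticFunction.moebius k : ℤ) : ℝ) ^ 2 / (Nat.totient k : ℝ)) / sieveS D := by
        apply Finset.sum_le_sum
        intro k hk
        have e : |sieveY D k| = (((ArithmeticFunction.moebius k : ℤ) : ℝ) ^ 2 / (Nat.totient k : ℝ)) / sieveS D := by
          unfold sieveY
          rw [abs_div, abs_moebius_sq, abs_of_nonneg (by positivity), div_div]
        have h1 : |((ArithmeticFunction.moebius (k / d) : ℤ) : ℝ)| ≤ 1 := by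
          exact_mod_cast ArithmeticFunction.abs_moebius_le_one
        split_ifs
        · rw [abs_mul, ← e]
          exact mul_le_of_le_one_left (abs_nonneg _) h1
        · rw [abs_zero]; positivity
    _ = 1 := by
        rw [← Finset.sum_div]
        exact div_self hS.ne'

lemma sieveW_one (D : ℕ) (hD : 1 ≤ D) : sieveW D 1 = 1 := by
  have hS := sieveS_pos D hD
  unfold sieveW
  have : ∀ k ∈ Finset.Icc 1 D, (if 1 ∣ k then ((ArithmeticFunction.moebius (k / 1) : ℤ) : ℝ) * sieveY D k else 0) =
      (((ArithmeticFunction.moebius k : ℤ) : ℝ) ^ 2 / (Nat.totient k : ℝ)) / sieveS D := by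
    intro k _
    simp only [one_dvd, if_true, Nat.div_one, sieveY]
    rw [div_div, sq, mul_div_assoc]
  rw [Finset.sum_congr rfl this, ← Finset.sum_div]
  exact div_self hS.ne'

lemma sieve_inner (D k l : ℕ) (hk : k ∈ Finset.Icc 1 D) (hl : l ∈ Finset.Icc 1 D) :
    ∑ d ∈ Finset.Icc 1 D, (if k ∣ d then (if d ∣ l then ((ArithmeticFunction.moebius (l / d) : ℤ) : ℝ) else 0) else 0) =
      if l = k then 1 else 0 := by
  classical
  rw [Finset.mem_Icc] at hk hl
  by_cases hkl : k ∣ l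
  · obtain ⟨t, rfl⟩ := hkl
    have ht : 0 < t := Nat.pos_of_ne_zero fun h => by subst h; simp at hl
    have e1 : ∑ d ∈ Finset.Icc 1 D, (if k ∣ d then (if d ∣ k * t then ((ArithmeticFunction.moebius (k * t / d) : ℤ) : ℝ) else 0) else 0)
        = ∑ c ∈ t.divisors, ((ArithmeticFunction.moebius (t / c) : ℤ) : ℝ) := by
      simp_rw [← ite_and]
      rw [← Finset.sum_filter]
      symm
      refine Finset.sum_bij (fun c _ => k * c) ?_ ?_ ?_ ?_
      · intro c hc
        rw [Nat.mem_divisors] at hc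
        have hc0 := Nat.pos_of_dvd_of_pos hc.1 ht
        have := Nat.le_of_dvd ht hc.1
        simp only [Finset.mem_filter, Finset.mem_Icc]
        refine ⟨⟨Nat.mul_pos hk.1 hc0, ?_⟩, Dvd.intro _ rfl, Nat.mul_dvd_mul_left k hc.1⟩
        exact le_trans (Nat.mul_le_mul_left k this) hl.2
      · intro c _ c' _ h
        exact Nat.eq_of_mul_eq_mul_left hk.1 h
      · intro d hd
        simp only [Finset.mem_filter, Finset.mem_Icc] at hd
        obtain ⟨_, ⟨c, rfl⟩, h2⟩ := hd
        exact ⟨c, Nat.mem_divisors.2 ⟨Nat.dvd_of_mul_dvd_mul_left hk.1 h2, ht.ne'⟩, rfl⟩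
      · intro c _
        rw [Nat.mul_div_mul_left _ _ hk.1]
    rw [e1, Nat.sum_div_divisors t (fun c => ((ArithmeticFunction.moebius c : ℤ) : ℝ))]
    have : ∑ c ∈ t.divisors, ArithmeticFunction.moebius c = if t = 1 then 1 else 0 := by
      have h0 := congrArg (fun f => f t) ArithmeticFunction.coe_zeta_mul_moebius
      simp only [ArithmeticFunction.coe_zeta_mul_apply, ArithmeticFunction.one_apply] at h0
      exact h0
    rw [← Int.cast_sum, this]
    by_cases h1 : t = 1
    · simp [h1]
    · have : ¬ k * t = k := fun h => h1 (Nat.eq_of_mul_eq_mul_left hk.1 (by simpa using h))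
      simp [h1, this]
  · have hne : l ≠ k := fun h => hkl (h ▸ dvd_rfl)
    rw [if_neg hne]
    apply Finset.sum_eq_zero
    intro d _
    split_ifs with h1 h2
    · exact absurd (h1.trans h2) hkl
    · rfl
    · rfl

lemma sieve_inv (D k : ℕ) (hk : k ∈ Finset.Icc 1 D) :
    ∑ d ∈ Finset.Icc 1 D, (if k ∣ d then sieveW D d else 0) = sieveY D k := by
  classical
  have : ∀ d ∈ Finset.Icc 1 D, (if k ∣ d then sieveW D d else 0) =
      ∑ l ∈ Finset.Icc 1 D, (if k ∣ d then (if d ∣ l then ((ArithmeticFunction.moebius (l / d) : ℤ) : ℝ) else 0) else 0) * sieveY D l := by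
    intro d _
    unfold sieveW
    split_ifs
    · refine Finset.sum_congr rfl fun l _ => ?_
      split_ifs <;> simp
    · simp
  rw [Finset.sum_congr rfl this, Finset.sum_comm]
  have h2 : ∀ l ∈ Finset.Icc 1 D, ∑ d ∈ Finset.Icc 1 D, (if k ∣ d then (if d ∣ l then ((ArithmeticFunction.moebius (l / d) : ℤ) : ℝ) else 0) else 0) * sieveY D l
      = (if l = k then 1 else 0) * sieveY D l := by
    intro l hl
    rw [← Finset.sum_mul, sieve_inner D k l hk hl]
  rw [Finset.sum_congr rfl h2]
  simp only [ite_mul, one_mul, zero_mul]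
  rw [Finset.sum_ite_eq' (Finset.Icc 1 D) k]
  rw [if_pos hk]

lemma sieve_quad (D : ℕ) (hD : 1 ≤ D) :
    ∑ d ∈ Finset.Icc 1 D, ∑ e ∈ Finset.Icc 1 D,
      (d * sieveW D d) * (e * sieveW D e) / (Nat.lcm d e : ℝ) = 1 / sieveS D := by
  classical
  have hS := sieveS_pos D hD
  have h1 : ∀ d ∈ Finset.Icc 1 D, ∀ e ∈ Finset.Icc 1 D,
      (d * sieveW D d) * (e * sieveW D e) / (Nat.lcm d e : ℝ) =
      ∑ k ∈ Finset.Icc 1 D, (Nat.totient k : ℝ) *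
        ((if k ∣ d then sieveW D d else 0) * (if k ∣ e then sieveW D e else 0)) := by
    intro d hd e he
    rw [Finset.mem_Icc] at hd he
    have hg : (Nat.gcd d e : ℝ) * (Nat.lcm d e : ℝ) = d * e := by
      exact_mod_cast Nat.gcd_mul_lcm d e
    have hl0 : (Nat.lcm d e : ℝ) ≠ 0 := by
      have := Nat.lcm_pos hd.1 he.1
      positivity
    have hgs : (Nat.gcd d e : ℝ) = ∑ k ∈ Finset.Icc 1 D,
        if k ∣ d ∧ k ∣ e then (Nat.totient k : ℝ) else 0 := by
      conv_lhs => rw [← Nat.sum_totient (Nat.gcd d e)]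
      rw [← Finset.sum_filter]
      push_cast
      refine Finset.sum_congr ?_ fun _ _ => rfl
      ext k
      simp only [Nat.mem_divisors, Finset.mem_filter, Finset.mem_Icc, Nat.dvd_gcd_iff]
      constructor
      · rintro ⟨h, _⟩
        exact ⟨⟨Nat.pos_of_dvd_of_pos h.1 hd.1, (Nat.le_of_dvd hd.1 h.1).trans hd.2⟩, h⟩
      · rintro ⟨_, h⟩
        exact ⟨h, (Nat.gcd_pos_of_pos_left e hd.1).ne'⟩
    have : (d * sieveW D d) * (e * sieveW D e) / (Nat.lcm d e : ℝ) =
        (Nat.gcd d e : ℝ) * (sieveW D d * sieveW D e) := by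
      rw [div_eq_iff hl0]
      linear_combination (-(sieveW D d * sieveW D e)) * hg
    rw [this, hgs, Finset.sum_mul]
    refine Finset.sum_congr rfl fun k _ => ?_
    by_cases a1 : k ∣ d <;> by_cases a2 : k ∣ e <;> simp [a1, a2]
  have h2 : ∑ d ∈ Finset.Icc 1 D, ∑ e ∈ Finset.Icc 1 D,
      (d * sieveW D d) * (e * sieveW D e) / (Nat.lcm d e : ℝ) =
      ∑ k ∈ Finset.Icc 1 D, (Nat.totient k : ℝ) * (sieveY D k) ^ 2 := by
    rw [Finset.sum_congr rfl fun d hd => Finset.sum_congr rfl (h1 d hd)]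
    rw [Finset.sum_congr rfl fun d hd => Finset.sum_comm, Finset.sum_comm]
    refine Finset.sum_congr rfl fun k hk => ?_
    rw [← sieve_inv D k hk, sq, Finset.sum_mul_sum, Finset.mul_sum]
    refine Finset.sum_congr rfl fun d _ => ?_
    rw [Finset.mul_sum]
  rw [h2]
  have h3 : ∀ k ∈ Finset.Icc 1 D, (Nat.totient k : ℝ) * (sieveY D k) ^ 2 =
      (((ArithmeticFunction.moebius k : ℤ) : ℝ) ^ 2 / (Nat.totient k : ℝ)) / (sieveS D) ^ 2 := by
    intro k hk
    rw [Finset.mem_Icc] at hk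
    have hpos : (0 : ℝ) < Nat.totient k := by exact_mod_cast Nat.totient_pos.2 (by omega)
    unfold sieveY
    field_simp
  rw [Finset.sum_congr rfl h3, ← Finset.sum_div]
  change sieveS D / sieveS D ^ 2 = _
  field_simp

lemma count_ap (q d M : ℕ) (hd : 0 < d) (hc : Nat.Coprime d q) :
    |(((Finset.Icc 1 M).filter fun m => d ∣ q * m + 1).card : ℝ) - M / d| ≤ 1 := by
  classical
  -- a residue class
  obtain ⟨v, hv⟩ : ∃ v : ℕ, ∀ m : ℕ, d ∣ q * m + 1 ↔ m ≡ v [MOD d] := by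
    have : NeZero d := ⟨hd.ne'⟩
    set u := ZMod.unitOfCoprime q hc.symm with hu
    refine ⟨(-(↑(u⁻¹) : ZMod d)).val, fun m => ?_⟩
    rw [← ZMod.natCast_eq_zero_iff, ← ZMod.natCast_eq_natCast_iff]
    push_cast
    rw [ZMod.natCast_zmod_val]
    have hqu : (q : ZMod d) = (u : ZMod d) := by simp [hu]
    rw [hqu]
    constructor
    · intro h
      have : (↑(u⁻¹) : ZMod d) * (↑u * (m : ZMod d) + 1) = 0 := by rw [h, mul_zero]
      rw [mul_add, ← mul_assoc, Units.inv_mul, one_mul, mul_one] at this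
      exact eq_neg_of_add_eq_zero_left this
    · intro h
      rw [h, mul_neg, Units.mul_inv]; simp
  have e : (Finset.Icc 1 M).filter (fun m => d ∣ q * m + 1) = (Finset.Ioc 0 M).filter (fun m => m ≡ v [MOD d]) := by
    ext m
    simp only [Finset.mem_filter, Finset.mem_Icc, Finset.mem_Ioc, hv]
    constructor <;> rintro ⟨h, h'⟩ <;> exact ⟨⟨by omega, by omega⟩, h'⟩
  rw [e]
  have hd' : (0 : ℝ) < d := by exact_mod_cast hd
  have h := Nat.Ioc_filter_modEq_card 0 M hd v
  have h' : (((Finset.Ioc 0 M).filter (fun m => m ≡ v [MOD d])).card : ℤ) =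
    max (⌊((M : ℚ) - v) / d⌋ - ⌊((0 : ℕ) - (v : ℚ)) / d⌋) 0 := h
  set A := ⌊((M : ℚ) - v) / d⌋ with hA
  set B := ⌊(((0 : ℕ) : ℚ) - (v : ℚ)) / d⌋ with hB
  have hAB : B ≤ A := by
    apply Int.floor_le_floor
    have : (0 : ℚ) < d := by exact_mod_cast hd
    gcongr
    exact Nat.zero_le M
  rw [max_eq_left (by omega)] at h'
  have h1 : (((Finset.Ioc 0 M).filter (fun m => m ≡ v [MOD d])).card : ℚ) = A - B := by
    exact_mod_cast h'
  have a1 := Int.floor_le (((M : ℚ) - v) / d)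
  have a2 := Int.lt_floor_add_one (((M : ℚ) - v) / d)
  have b1 := Int.floor_le ((((0 : ℕ) : ℚ) - (v : ℚ)) / d)
  have b2 := Int.lt_floor_add_one ((((0 : ℕ) : ℚ) - (v : ℚ)) / d)
  have hs : ((M : ℚ) - v) / d - (((0 : ℕ) : ℚ) - (v : ℚ)) / d = (M : ℚ) / d := by
    rw [← sub_div]; congr 1; push_cast; ring
  have h2 : |(((Finset.Ioc 0 M).filter (fun m => m ≡ v [MOD d])).card : ℚ) - M / d| ≤ 1 := by
    rw [← hA] at a1 a2
    rw [← hB] at b1 b2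
    rw [h1, ← hs, abs_le]
    constructor <;> linarith
  have h3 : ((|(((Finset.Ioc 0 M).filter (fun m => m ≡ v [MOD d])).card : ℚ) - M / d| : ℚ) : ℝ) ≤
      ((1 : ℚ) : ℝ) := Rat.cast_le.2 h2
  push_cast at h3
  exact h3

lemma sieve_bound (q D M : ℕ) (hD : 1 ≤ D) (hDq : D ≤ q)
    (hc : ∀ d, 1 ≤ d → d ≤ D → Nat.Coprime d q) :
    (((Finset.Icc 1 M).filter fun m => (q * m + 1).Prime).card : ℝ) ≤
      M / sieveS D + (D : ℝ) ^ 4 := by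
  classical
  set lam : ℕ → ℝ := fun d => d * sieveW D d with hlam
  have habs : ∀ d ∈ Finset.Icc 1 D, |lam d| ≤ D := by
    intro d hd
    rw [Finset.mem_Icc] at hd
    simp only [hlam]
    rw [abs_mul, Nat.abs_cast]
    have h1 := sieveW_abs D d hD
    have h2 : (d : ℝ) ≤ D := by exact_mod_cast hd.2
    calc (d : ℝ) * |sieveW D d| ≤ d * 1 := by gcongr
      _ ≤ D := by linarith
  have step1 : (((Finset.Icc 1 M).filter fun m => (q * m + 1).Prime).card : ℝ) ≤
      ∑ m ∈ Finset.Icc 1 M, (∑ d ∈ Finset.Icc 1 D, if d ∣ q * m + 1 then lam d else 0) ^ 2 := by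
    rw [Finset.card_filter]
    push_cast
    apply Finset.sum_le_sum
    intro m hm
    rw [Finset.mem_Icc] at hm
    split_ifs with hp
    · have : (∑ d ∈ Finset.Icc 1 D, if d ∣ q * m + 1 then lam d else 0) = 1 := by
        rw [Finset.sum_eq_single 1]
        · simp [hlam, sieveW_one D hD]
        · intro d hd hd1
          rw [Finset.mem_Icc] at hd
          rw [if_neg]
          intro hdv
          rcases (Nat.dvd_prime hp).1 hdv with h | h
          · exact hd1 h
          · nlinarith
        · intro h
          exact absurd (Finset.mem_Icc.2 ⟨le_rfl, hD⟩) h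
      rw [this]; norm_num
    · positivity
  have step2 : ∑ m ∈ Finset.Icc 1 M, (∑ d ∈ Finset.Icc 1 D, if d ∣ q * m + 1 then lam d else 0) ^ 2 =
      ∑ d ∈ Finset.Icc 1 D, ∑ e ∈ Finset.Icc 1 D, lam d * lam e *
        (((Finset.Icc 1 M).filter fun m => Nat.lcm d e ∣ q * m + 1).card : ℝ) := by
    have : ∀ m ∈ Finset.Icc 1 M, (∑ d ∈ Finset.Icc 1 D, if d ∣ q * m + 1 then lam d else 0) ^ 2 =
        ∑ d ∈ Finset.Icc 1 D, ∑ e ∈ Finset.Icc 1 D,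
          if Nat.lcm d e ∣ q * m + 1 then lam d * lam e else 0 := by
      intro m _
      rw [sq, Finset.sum_mul_sum]
      refine Finset.sum_congr rfl fun d _ => Finset.sum_congr rfl fun e _ => ?_
      simp only [Nat.lcm_dvd_iff]
      by_cases a1 : d ∣ q * m + 1 <;> by_cases a2 : e ∣ q * m + 1 <;> simp [a1, a2]
    rw [Finset.sum_congr rfl this, Finset.sum_comm]
    refine Finset.sum_congr rfl fun d _ => ?_
    rw [Finset.sum_comm]
    refine Finset.sum_congr rfl fun e _ => ?_
    rw [← Finset.sum_filter, Finset.sum_const, nsmul_eq_mul, mul_comm]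
  rw [step2] at step1
  refine step1.trans ?_
  have step3 : ∀ d ∈ Finset.Icc 1 D, ∀ e ∈ Finset.Icc 1 D, lam d * lam e *
        (((Finset.Icc 1 M).filter fun m => Nat.lcm d e ∣ q * m + 1).card : ℝ) ≤
        M * (lam d * lam e / (Nat.lcm d e : ℝ)) + (D : ℝ) ^ 2 := by
    intro d hd e he
    have hd' := Finset.mem_Icc.1 hd
    have he' := Finset.mem_Icc.1 he
    have hl := count_ap q (Nat.lcm d e) M (Nat.lcm_pos hd'.1 he'.1)
      (Nat.Coprime.coprime_dvd_left (Nat.lcm_dvd_mul d e) (Nat.Coprime.mul_left (hc d hd'.1 hd'.2) (hc e he'.1 he'.2)))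
    set c := (((Finset.Icc 1 M).filter fun m => Nat.lcm d e ∣ q * m + 1).card : ℝ)
    have h1 : lam d * lam e * (c - M / (Nat.lcm d e : ℝ)) ≤ (D : ℝ) ^ 2 := by
      refine (le_abs_self _).trans ?_
      rw [abs_mul, abs_mul]
      have := habs d hd
      have := habs e he
      calc |lam d| * |lam e| * |c - M / (Nat.lcm d e : ℝ)| ≤ D * D * 1 := by gcongr
        _ = (D : ℝ) ^ 2 := by ring
    have : M * (lam d * lam e / (Nat.lcm d e : ℝ)) = lam d * lam e * (M / (Nat.lcm d e : ℝ)) := by ring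
    rw [this]
    linarith
  refine (Finset.sum_le_sum fun d hd => Finset.sum_le_sum (step3 d hd)).trans ?_
  have hq := sieve_quad D hD
  simp only [Finset.sum_add_distrib, ← Finset.mul_sum]
  rw [hq]
  simp
  apply le_of_eq
  ring

/-! ### Dyadic sums -/

lemma block_card (i : ℕ) (hi : 1 ≤ i) (s : Finset ℕ) (hs : ∀ p ∈ s, p.Prime ∧ Nat.log 2 p = i) :
    (s.card : ℝ) ≤ 4 * 2 ^ i / i := by
  have hi0 : (0 : ℝ) < i := by exact_mod_cast hi
  have hl2 : 0 < Real.log 2 := Real.log_pos (by norm_num)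
  have h1 : (s.card : ℝ) * (i * Real.log 2) ≤ Chebyshev.theta ((2 : ℝ) ^ (i + 1)) := by
    unfold Chebyshev.theta
    rw [← nsmul_eq_mul, ← Finset.sum_const]
    have hfl : ⌊(2 : ℝ) ^ (i + 1)⌋₊ = 2 ^ (i + 1) := by
      have : ((2 : ℝ) ^ (i + 1)) = ((2 ^ (i + 1) : ℕ) : ℝ) := by push_cast; rfl
      rw [this, Nat.floor_natCast]
    rw [hfl]
    refine (Finset.sum_le_sum (f := fun _ => (i : ℝ) * Real.log 2) (g := fun p : ℕ => Real.log p) ?_).trans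
      (Finset.sum_le_sum_of_subset_of_nonneg ?_ ?_)
    · intro p hp
      obtain ⟨hp1, hp2⟩ := hs p hp
      have : 2 ^ i ≤ p := by
        rw [← hp2]; exact Nat.pow_log_le_self 2 hp1.ne_zero
      rw [← Real.log_pow]
      apply Real.log_le_log (by positivity)
      exact_mod_cast this
    · intro p hp
      obtain ⟨hp1, hp2⟩ := hs p hp
      have : p < 2 ^ (i + 1) := by
        rw [← hp2]; exact Nat.lt_pow_succ_log_self (by norm_num) p
      simp only [Finset.mem_filter, Finset.mem_Ioc]
      exact ⟨⟨hp1.pos, this.le⟩, hp1⟩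
    · intro p hp _
      simp only [Finset.mem_filter, Finset.mem_Ioc] at hp
      exact Real.log_nonneg (by exact_mod_cast hp.1.1)
  have h2 := Chebyshev.theta_le_log4_mul_x (x := (2 : ℝ) ^ (i + 1)) (by positivity)
  have h4 : Real.log 4 = 2 * Real.log 2 := by
    rw [show (4 : ℝ) = 2 ^ 2 by norm_num, Real.log_pow]; norm_num
  rw [h4] at h2
  rw [le_div_iff₀ hi0]
  have h3 : (s.card * i) * Real.log 2 ≤ (4 * 2 ^ i) * Real.log 2 := by
    have := h1.trans h2
    rw [pow_succ] at this
    linarith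
  exact le_of_mul_le_mul_right h3 hl2

lemma dyadic_sum (s : Finset ℕ) (f N g : ℕ → ℝ) (I L : ℕ)
    (h1 : ∀ n ∈ s, I ≤ Nat.log 2 n ∧ Nat.log 2 n ≤ L)
    (h2 : ∀ n ∈ s, f n ≤ g (Nat.log 2 n)) (hg : ∀ i, I ≤ i → 0 ≤ g i)
    (h3 : ∀ i, I ≤ i → ((s.filter fun n => Nat.log 2 n = i).card : ℝ) ≤ N i) :
    ∑ n ∈ s, f n ≤ ∑ i ∈ Finset.Icc I L, N i * g i := by
  rw [← Finset.sum_fiberwise_of_maps_to (s := s) (t := Finset.Icc I L) (g := Nat.log 2)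
    (fun n hn => Finset.mem_Icc.2 (h1 n hn))]
  apply Finset.sum_le_sum
  intro i hi
  rw [Finset.mem_Icc] at hi
  calc ∑ n ∈ s.filter (fun n => Nat.log 2 n = i), f n
      ≤ ∑ n ∈ s.filter (fun n => Nat.log 2 n = i), g i := by
        apply Finset.sum_le_sum
        intro n hn
        rw [Finset.mem_filter] at hn
        rw [← hn.2]
        exact h2 n hn.1
    _ = ((s.filter fun n => Nat.log 2 n = i).card : ℝ) * g i := by
        rw [Finset.sum_const, nsmul_eq_mul]
    _ ≤ N i * g i := mul_le_mul_of_nonneg_right (h3 i hi.1) (hg i hi.1)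

lemma two_pow_log_le (n : ℕ) (hn : n ≠ 0) : (2 : ℝ) ^ (Nat.log 2 n) ≤ n := by
  exact_mod_cast Nat.pow_log_le_self 2 hn

/-- Tail of `1 / i ^ 2`. -/
lemma tail_inv_sq (I L : ℕ) (hI : 1 ≤ I) :
    ∑ i ∈ Finset.Icc I L, (1 : ℝ) / (i : ℝ) ^ 2 ≤ 2 / I := by
  have := sum_Ioo_inv_sq_le (α := ℝ) (I - 1) (L + 1)
  have he : Finset.Ioo (I - 1) (L + 1) = Finset.Icc I L := by ext; simp; omega
  rw [he] at this
  have hc : ((I - 1 : ℕ) : ℝ) + 1 = I := by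
    rw [Nat.cast_sub hI]; simp
  rw [hc] at this
  simpa using this

lemma tail_log_sq (I L : ℕ) (hI : 1 ≤ I) :
    ∑ i ∈ Finset.Icc I L, Real.log i / (i : ℝ) ^ 2 ≤ 2 * (Real.log I + 1) / I := by
  have hstep : ∀ i : ℕ, 1 ≤ i → Real.log i / (i : ℝ) ^ 2 ≤
      2 * (Real.log i + 1) / i - 2 * (Real.log (i + 1 : ℕ) + 1) / (i + 1 : ℕ) := by
    intro i hi
    have hi0 : (1 : ℝ) ≤ i := by exact_mod_cast hi
    have hip : (0 : ℝ) < i := by linarith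
    have hlog : Real.log ((i + 1 : ℕ) : ℝ) ≤ Real.log i + 1 / i := by
      have : Real.log ((i + 1 : ℕ) : ℝ) - Real.log i ≤ 1 / i := by
        rw [← Real.log_div (by positivity) (by positivity)]
        have := Real.log_le_sub_one_of_pos (x := ((i + 1 : ℕ) : ℝ) / i) (by positivity)
        refine this.trans (le_of_eq ?_)
        push_cast
        field_simp
        ring
      linarith
    have hl0 : 0 ≤ Real.log i := Real.log_nonneg hi0
    have h1 : (i : ℝ) * Real.log ((i + 1 : ℕ) : ℝ) ≤ i * Real.log i + 1 := by
      have := mul_le_mul_of_nonneg_left hlog hip.le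
      rw [mul_add, mul_one_div_cancel hip.ne'] at this
      exact this
    set l := Real.log i
    set l' := Real.log ((i + 1 : ℕ) : ℝ)
    have e : 2 * (l + 1) / i - 2 * (l' + 1) / (i + 1 : ℕ) =
        2 * (l + 1 - (i * l' - i * l)) / (i * (i + 1)) := by
      push_cast
      field_simp
      ring
    rw [e]
    calc l / (i : ℝ) ^ 2 ≤ 2 * l / (i * (i + 1)) := by
          rw [div_le_div_iff₀ (by positivity) (by positivity)]
          nlinarith [mul_nonneg hl0 hip.le, mul_nonneg (mul_nonneg hl0 hip.le) (sub_nonneg.2 hi0)]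
      _ ≤ _ := by
          gcongr
          linarith
  rcases lt_or_ge L I with h | h
  · rw [Finset.Icc_eq_empty (by omega)]
    have : 0 ≤ Real.log I := Real.log_natCast_nonneg I
    simp only [Finset.sum_empty]
    positivity
  · have key : ∀ L, I ≤ L → ∑ i ∈ Finset.Icc I L, Real.log i / (i : ℝ) ^ 2 ≤
        2 * (Real.log I + 1) / I - 2 * (Real.log (L + 1 : ℕ) + 1) / (L + 1 : ℕ) := by
      intro L hL
      induction L, hL using Nat.le_induction with
      | base => simpa using hstep I hI
      | succ L hL ih =>
        rw [Finset.sum_Icc_succ_top (by omega)]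
        have := hstep (L + 1) (by omega)
        linarith
    have h0 : 0 ≤ 2 * (Real.log (L + 1 : ℕ) + 1) / ((L + 1 : ℕ) : ℝ) := by
      have : 0 ≤ Real.log (L + 1 : ℕ) := Real.log_natCast_nonneg _
      positivity
    linarith [key L h]

lemma tail_geom (I L : ℕ) : ∑ i ∈ Finset.Icc I L, (1 : ℝ) / 2 ^ i ≤ 2 / 2 ^ I := by
  rcases lt_or_ge L I with h | h
  · rw [Finset.Icc_eq_empty (by omega)]
    simp only [Finset.sum_empty]
    positivity
  · have key : ∀ L, I ≤ L → ∑ i ∈ Finset.Icc I L, (1 : ℝ) / 2 ^ i ≤ 2 / 2 ^ I - 1 / 2 ^ L := by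
      intro L hL
      induction L, hL using Nat.le_induction with
      | base =>
        simp only [Finset.Icc_self, Finset.sum_singleton]
        rw [← sub_div]; norm_num
      | succ L hL ih =>
        rw [Finset.sum_Icc_succ_top (by omega)]
        have : (1 : ℝ) / 2 ^ L = 2 * (1 / 2 ^ (L + 1)) := by
          rw [pow_succ]; field_simp
        linarith
    have h0 : (0 : ℝ) ≤ 1 / 2 ^ L := by positivity
    linarith [key L h]

lemma sum_prime_inv_sq (s : Finset ℕ) (I : ℕ) (hI : 1 ≤ I)
    (hs : ∀ q ∈ s, q.Prime ∧ I ≤ Nat.log 2 q) :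
    ∑ q ∈ s, (1 : ℝ) / (q : ℝ) ^ 2 ≤ 8 / (I * 2 ^ I) := by
  have hI0 : (0 : ℝ) < I := by exact_mod_cast hI
  refine (dyadic_sum s _ (fun i => 4 * 2 ^ i / i) (fun i => 1 / ((2 : ℝ) ^ i) ^ 2) I (s.sup (Nat.log 2))
    (fun n hn => ⟨(hs n hn).2, Finset.le_sup (f := Nat.log 2) hn⟩) ?_ (fun i _ => by positivity) ?_).trans ?_
  · intro n hn
    have := two_pow_log_le n (hs n hn).1.ne_zero
    gcongr
  · intro i hi
    apply block_card i (by omega)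
    intro p hp
    rw [Finset.mem_filter] at hp
    exact ⟨(hs p hp.1).1, hp.2⟩
  · calc _ ≤ ∑ i ∈ Finset.Icc I (s.sup (Nat.log 2)), (4 / (I : ℝ)) * (1 / 2 ^ i) := by
          apply Finset.sum_le_sum
          intro i hi
          rw [Finset.mem_Icc] at hi
          have h1 : (I : ℝ) ≤ i := by exact_mod_cast hi.1
          have e : 4 * 2 ^ i / (i : ℝ) * (1 / ((2 : ℝ) ^ i) ^ 2) = (4 / (i : ℝ)) * (1 / 2 ^ i) := by
            have : (0 : ℝ) < i := by linarith
            field_simp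
          rw [e]
          gcongr
      _ ≤ (4 / (I : ℝ)) * (2 / 2 ^ I) := by
          rw [← Finset.mul_sum]
          exact mul_le_mul_of_nonneg_left (tail_geom _ _) (by positivity)
      _ = _ := by field_simp; norm_num

lemma log_ge_half (n : ℕ) (hn : n ≠ 0) : (Nat.log 2 n : ℝ) / 2 ≤ Real.log n := by
  have h1 := two_pow_log_le n hn
  have h2 := Real.log_le_log (by positivity) h1
  rw [Real.log_pow] at h2
  have := Real.log_two_gt_d9
  have h0 : (0 : ℝ) ≤ Nat.log 2 n := by positivity
  nlinarith

lemma sum_prime_inv_log (s : Finset ℕ) (I : ℕ) (hI : 1 ≤ I)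
    (hs : ∀ q ∈ s, q.Prime ∧ I ≤ Nat.log 2 q) :
    ∑ q ∈ s, (1 : ℝ) / ((q : ℝ) * Real.log q) ≤ 16 / I := by
  have hI0 : (0 : ℝ) < I := by exact_mod_cast hI
  refine (dyadic_sum s _ (fun i => 4 * 2 ^ i / i) (fun i => 1 / ((2 : ℝ) ^ i * (i / 2))) I (s.sup (Nat.log 2))
    (fun n hn => ⟨(hs n hn).2, Finset.le_sup (f := Nat.log 2) hn⟩) ?_ (fun i _ => by positivity) ?_).trans ?_
  · intro n hn
    have h1 := two_pow_log_le n (hs n hn).1.ne_zero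
    have h2 := log_ge_half n (hs n hn).1.ne_zero
    have h3 : (0 : ℝ) < Nat.log 2 n := by
      have := (hs n hn).2
      exact_mod_cast (by omega : 0 < Nat.log 2 n)
    gcongr
  · intro i hi
    apply block_card i (by omega)
    intro p hp
    rw [Finset.mem_filter] at hp
    exact ⟨(hs p hp.1).1, hp.2⟩
  · calc _ ≤ ∑ i ∈ Finset.Icc I (s.sup (Nat.log 2)), (8 : ℝ) * (1 / (i : ℝ) ^ 2) := by
          refine le_of_eq (Finset.sum_congr rfl ?_)
          intro i hi
          rw [Finset.mem_Icc] at hi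
          have h1 : (I : ℝ) ≤ i := by exact_mod_cast hi.1
          have : (0 : ℝ) < i := by linarith
          field_simp
          norm_num
      _ ≤ (8 : ℝ) * (2 / (I : ℝ)) := by
          rw [← Finset.mul_sum]
          exact mul_le_mul_of_nonneg_left (tail_inv_sq _ _ hI) (by positivity)
      _ = _ := by field_simp; norm_num

/-! ### Primes `r` with a small residual index -/

lemma card_primeFactors_pow_sub (a k : ℕ) (ha : 1 < a) (hk : 1 ≤ k) :
    (a ^ k - 1).primeFactors.card ≤ a * k := by
  have hpos : 0 < a ^ k - 1 := by
    have := Nat.one_lt_pow (by omega : k ≠ 0) ha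
    omega
  have h1 : 2 ^ (a ^ k - 1).primeFactors.card ≤ ∏ p ∈ (a ^ k - 1).primeFactors, p := by
    apply Finset.pow_card_le_prod
    intro p hp
    exact (Nat.prime_of_mem_primeFactors hp).two_le
  have h2 : ∏ p ∈ (a ^ k - 1).primeFactors, p ≤ a ^ k - 1 :=
    Nat.le_of_dvd hpos (Nat.prod_primeFactors_dvd _)
  have h3 : a ^ k ≤ 2 ^ (a * k) := by
    rw [pow_mul]
    exact Nat.pow_le_pow_left (Nat.lt_two_pow_self).le k
  exact (Nat.pow_le_pow_iff_right (by norm_num : 1 < 2)).1 (by omega)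

lemma card_small_order (a K : ℕ) (ha : 1 < a) (s : Finset ℕ)
    (hs : ∀ r ∈ s, r.Prime ∧ ∃ k, 1 ≤ k ∧ k ≤ K ∧ (a : ZMod r) ^ k = 1) :
    s.card ≤ a * K ^ 2 := by
  classical
  have hsub : s ⊆ (Finset.Icc 1 K).biUnion fun k => (a ^ k - 1).primeFactors := by
    intro r hr
    obtain ⟨hp, k, hk1, hk2, hk⟩ := hs r hr
    rw [Finset.mem_biUnion]
    refine ⟨k, Finset.mem_Icc.2 ⟨hk1, hk2⟩, ?_⟩
    have hlt := Nat.one_lt_pow (by omega : k ≠ 0) ha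
    rw [Nat.mem_primeFactors]
    refine ⟨hp, ?_, by omega⟩
    rw [← ZMod.natCast_eq_zero_iff, Nat.cast_sub hlt.le]
    push_cast
    rw [hk, sub_self]
  refine (Finset.card_le_card hsub).trans (Finset.card_biUnion_le.trans ?_)
  calc ∑ k ∈ Finset.Icc 1 K, (a ^ k - 1).primeFactors.card
      ≤ ∑ k ∈ Finset.Icc 1 K, a * K := by
        apply Finset.sum_le_sum
        intro k hk
        rw [Finset.mem_Icc] at hk
        exact (card_primeFactors_pow_sub a k ha hk.1).trans (Nat.mul_le_mul_left a hk.2)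
    _ = a * K ^ 2 := by simp; ring

lemma growth (j : ℕ) (hj : 60 ≤ j) :
    ((2 : ℝ) ^ (j / 20)) ^ 4 * (j : ℝ) ^ 2 ≤ Real.sqrt (2 ^ j) := by
  apply Real.le_sqrt_of_sq_le
  set h := j / 20 with hh
  have hh3 : 3 ≤ h := by omega
  have hj1 : j ≤ 20 * (h + 1) := by omega
  have hj2 : 20 * h ≤ j := by omega
  have h1 : j ^ 4 ≤ 2 ^ (12 * h) := by
    calc j ^ 4 ≤ (20 * (h + 1)) ^ 4 := Nat.pow_le_pow_left hj1 4
      _ = 20 ^ 4 * (h + 1) ^ 4 := by ring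
      _ ≤ 2 ^ 24 * (2 ^ h) ^ 4 := by
          apply Nat.mul_le_mul (by norm_num)
          exact Nat.pow_le_pow_left (Nat.lt_two_pow_self) 4
      _ ≤ 2 ^ (8 * h) * (2 ^ h) ^ 4 := by
          apply Nat.mul_le_mul_right
          exact Nat.pow_le_pow_right (by norm_num) (by omega)
      _ = 2 ^ (12 * h) := by rw [← pow_mul, ← pow_add]; congr 1; ring
  have h2 : (2 ^ h) ^ 8 * j ^ 4 ≤ 2 ^ j := by
    calc (2 ^ h) ^ 8 * j ^ 4 ≤ (2 ^ h) ^ 8 * 2 ^ (12 * h) := Nat.mul_le_mul_left _ h1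
      _ = 2 ^ (20 * h) := by rw [← pow_mul, ← pow_add]; congr 1; ring
      _ ≤ 2 ^ j := Nat.pow_le_pow_right (by norm_num) hj2
  have h3 : (((2 : ℝ) ^ h) ^ 8) * (j : ℝ) ^ 4 ≤ 2 ^ j := by exact_mod_cast h2
  calc (((2 : ℝ) ^ h) ^ 4 * (j : ℝ) ^ 2) ^ 2 = (((2 : ℝ) ^ h) ^ 8) * (j : ℝ) ^ 4 := by ring
    _ ≤ _ := h3

lemma one_le_log_of (j : ℕ) (hj : 3 ≤ j) : 1 ≤ Real.log j := by
  rw [Real.le_log_iff_exp_le (by positivity)]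
  have := Real.exp_one_lt_d9
  have h : (3 : ℝ) ≤ j := by exact_mod_cast hj
  linarith

lemma sum_window (j : ℕ) (hj : 60 ≤ j) (s : Finset ℕ)
    (hs : ∀ q ∈ s, q.Prime ∧ Real.sqrt (2 ^ j) / (j : ℝ) ^ 2 < q ∧ (q : ℝ) ≤ Real.sqrt (2 ^ j) * j) :
    ∑ q ∈ s, (1 : ℝ) / q ≤ 320 * Real.log j / j := by
  set w := Real.sqrt (2 ^ j) with hw
  have hw0 : 0 < w := Real.sqrt_pos.2 (by positivity)
  have hj0 : (0 : ℝ) < j := by exact_mod_cast (by omega : 0 < j)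
  have hgr := growth j hj
  rw [← hw] at hgr
  set h := j / 20 with hh
  set A := ⌊w / (j : ℝ) ^ 2⌋₊ with hA
  set B := ⌊w * j⌋₊ with hB
  have hA1 : 2 ^ (4 * h) ≤ A := by
    apply Nat.le_floor
    rw [le_div_iff₀ (by positivity)]
    push_cast
    refine le_trans (le_of_eq ?_) hgr
    ring
  have hA0 : A ≠ 0 := by
    have : 0 < 2 ^ (4 * h) := by positivity
    omega
  have hi0 : 4 * h ≤ Nat.log 2 A := Nat.le_log_of_pow_le (by norm_num) hA1
  set i0 := Nat.log 2 A with hi0d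
  set i1 := Nat.log 2 B with hi1d
  have hi0j : (j : ℝ) / 10 ≤ i0 := by
    have : j ≤ 10 * i0 := by omega
    have : (j : ℝ) ≤ 10 * i0 := by exact_mod_cast this
    linarith
  have hi0p : 1 ≤ i0 := by omega
  have hlogj := one_le_log_of j (by omega)
  have h1 : w / (j : ℝ) ^ 2 < 2 ^ (i0 + 1) := by
    have h2 : A < 2 ^ (i0 + 1) := Nat.lt_pow_succ_log_self (by norm_num) A
    have h3 := Nat.lt_floor_add_one (w / (j : ℝ) ^ 2)
    have h4 : ((A + 1 : ℕ) : ℝ) ≤ ((2 ^ (i0 + 1) : ℕ) : ℝ) := by exact_mod_cast h2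
    push_cast at h4
    linarith
  have hB0 : B ≠ 0 := by
    have : A ≤ B := by
      apply Nat.floor_le_floor
      rw [div_le_iff₀ (by positivity)]
      have : (1 : ℝ) ≤ j := by exact_mod_cast (by omega : 1 ≤ j)
      have : (1 : ℝ) ≤ (j : ℝ) ^ 3 := one_le_pow₀ this
      nlinarith
    omega
  have h2 : (2 : ℝ) ^ i1 ≤ w * j :=
    (two_pow_log_le B hB0).trans (Nat.floor_le (by positivity))
  have h3 : (2 : ℝ) ^ i1 < (j : ℝ) ^ 3 * 2 ^ (i0 + 1) := by
    rw [div_lt_iff₀ (by positivity)] at h1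
    calc (2 : ℝ) ^ i1 ≤ w * j := h2
      _ < (2 ^ (i0 + 1) * (j : ℝ) ^ 2) * j := by gcongr
      _ = _ := by ring
  have h4 : (i1 : ℝ) ≤ 6 * Real.log j + i0 + 1 := by
    have h5 := Real.log_le_log (by positivity) h3.le
    rw [Real.log_mul (by positivity) (by positivity), Real.log_pow, Real.log_pow, Real.log_pow] at h5
    push_cast at h5
    have hl2 := Real.log_two_gt_d9
    by_contra hcon
    push Not at hcon
    nlinarith
  refine (dyadic_sum s _ (fun i => 4 * 2 ^ i / i) (fun i => 1 / ((2 : ℝ) ^ i)) i0 i1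
    ?_ ?_ (fun i _ => by positivity) ?_).trans ?_
  · intro n hn
    obtain ⟨_, hn2, hn3⟩ := hs n hn
    constructor
    · apply Nat.log_mono_right
      have := Nat.floor_le_floor hn2.le
      rwa [Nat.floor_natCast] at this
    · apply Nat.log_mono_right
      exact Nat.le_floor hn3
  · intro n hn
    have := two_pow_log_le n (hs n hn).1.ne_zero
    gcongr
  · intro i hi
    apply block_card i (by omega)
    intro p hp
    rw [Finset.mem_filter] at hp
    exact ⟨(hs p hp.1).1, hp.2⟩
  · calc _ ≤ ∑ i ∈ Finset.Icc i0 i1, (40 : ℝ) / j := by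
          apply Finset.sum_le_sum
          intro i hi
          rw [Finset.mem_Icc] at hi
          have hii : (i0 : ℝ) ≤ i := by exact_mod_cast hi.1
          have hi' : (0 : ℝ) < i := by linarith [div_pos hj0 (by norm_num : (0 : ℝ) < 10)]
          have e : 4 * 2 ^ i / (i : ℝ) * (1 / (2 : ℝ) ^ i) = 4 / (i : ℝ) := by
            field_simp
          rw [e, div_le_div_iff₀ hi' hj0]
          linarith
      _ = ((Finset.Icc i0 i1).card : ℝ) * (40 / (j : ℝ)) := by
          rw [Finset.sum_const, nsmul_eq_mul]
      _ ≤ (8 * Real.log j) * (40 / (j : ℝ)) := by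
          gcongr
          rw [Nat.card_Icc]
          rcases le_or_gt i0 (i1 + 1) with h5 | h5
          · rw [Nat.cast_sub h5]
            push_cast
            linarith
          · have : i1 + 1 - i0 = 0 := by omega
            rw [this]
            push_cast
            linarith
      _ = _ := by ring

lemma bad_primes (a : ℕ) (ha : 1 < a) (j : ℕ) (hj : 60 ≤ j) (s : Finset ℕ)
    (hs : ∀ r ∈ s, Nat.log 2 r = j ∧ r.Prime ∧ ∃ q : ℕ, q.Prime ∧ r % q = 1 ∧
      (a : ZMod r) ^ ((r - 1) / q) = 1 ∧ (r : ℝ) < (q : ℝ) ^ 2 * (Real.log q) ^ 4) :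
    (s.card : ℝ) ≤ (4 * a + 321 * 320) * (2 ^ j * (Real.log j / (j : ℝ) ^ 2)) := by
  classical
  set w := Real.sqrt (2 ^ j) with hw
  have hw0 : 0 < w := Real.sqrt_pos.2 (by positivity)
  have hww : w ^ 2 = 2 ^ j := Real.sq_sqrt (by positivity)
  have hj0 : (0 : ℝ) < j := by exact_mod_cast (by omega : 0 < j)
  have hgr := growth j hj
  rw [← hw] at hgr
  have hlogj := one_le_log_of j (by omega)
  set K := ⌊2 * w / j⌋₊ with hK
  set s1 := s.filter fun r => ∃ k, 1 ≤ k ∧ k ≤ K ∧ (a : ZMod r) ^ k = 1 with hs1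
  set s2 := s.filter fun r => ¬ ∃ k, 1 ≤ k ∧ k ≤ K ∧ (a : ZMod r) ^ k = 1 with hs2
  have hcard : s.card = s1.card + s2.card := (Finset.card_filter_add_card_filter_not _).symm
  -- first part
  have c1 : (s1.card : ℝ) ≤ 4 * a * (2 ^ j * (Real.log j / (j : ℝ) ^ 2)) := by
    have h1 : s1.card ≤ a * K ^ 2 := by
      apply card_small_order a K ha
      intro r hr
      rw [hs1, Finset.mem_filter] at hr
      exact ⟨(hs r hr.1).2.1, hr.2⟩
    have h2 : (s1.card : ℝ) ≤ a * (K : ℝ) ^ 2 := by exact_mod_cast h1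
    have h3 : (K : ℝ) ≤ 2 * w / j := Nat.floor_le (by positivity)
    calc (s1.card : ℝ) ≤ a * (K : ℝ) ^ 2 := h2
      _ ≤ a * (2 * w / j) ^ 2 := by gcongr
      _ = 4 * a * (2 ^ j * (1 / (j : ℝ) ^ 2)) := by rw [← hww]; field_simp; ring
      _ ≤ _ := by gcongr
  -- second part
  set N := 2 ^ (j + 1) with hN
  set Q := (Finset.range (N + 1)).filter fun q : ℕ => q.Prime ∧ w / (j : ℝ) ^ 2 < q ∧ (q : ℝ) ≤ w * j with hQ
  set h := j / 20 with hh
  have hh1 : j ≤ 40 * h := by omega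
  set D := 2 ^ h with hD
  have hsub : s2 ⊆ Q.biUnion fun q => ((Finset.Icc 1 (N / q)).filter fun m => (q * m + 1).Prime).image
      fun m => q * m + 1 := by
    intro r hr
    rw [hs2, Finset.mem_filter] at hr
    obtain ⟨hrs, hrk⟩ := hr
    obtain ⟨hlr, hrp, q, hq, hmod, hpow, hlt⟩ := hs r hrs
    have hr1 : 2 ^ j ≤ r := by rw [← hlr]; exact Nat.pow_log_le_self 2 hrp.ne_zero
    have hr2 : r < N := by rw [hN, ← hlr]; exact Nat.lt_pow_succ_log_self (by norm_num) r
    have hr1' : w ^ 2 ≤ r := by rw [hww]; exact_mod_cast hr1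
    have hr2' : (r : ℝ) < 2 * w ^ 2 := by
      rw [hww, ← pow_succ']; exact_mod_cast hr2
    set m := r / q with hm
    have hrm : r = q * m + 1 := by
      have := Nat.div_add_mod r q
      rw [hmod] at this
      exact this.symm
    have hm1 : 1 ≤ m := by
      by_contra hc
      have : m = 0 := Nat.lt_one_iff.1 (not_le.1 hc)
      rw [this] at hrm
      have := hrp.two_le
      omega
    have hdiv : (r - 1) / q = m := by
      rw [hrm, Nat.add_sub_cancel, Nat.mul_div_cancel_left _ hq.pos]
    rw [hdiv] at hpow
    have hmK : K < m := by
      by_contra hc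
      exact hrk ⟨m, hm1, by omega, hpow⟩
    have hqr : q < r := by rw [hrm]; nlinarith
    have hq0 : (0 : ℝ) < q := by exact_mod_cast hq.pos
    have hq1 : (1 : ℝ) ≤ q := by exact_mod_cast hq.one_lt.le
    have hrmR : (r : ℝ) = q * m + 1 := by exact_mod_cast hrm
    rw [Finset.mem_biUnion]
    refine ⟨q, ?_, ?_⟩
    · rw [hQ, Finset.mem_filter, Finset.mem_range]
      refine ⟨by omega, hq, ?_, ?_⟩
      · have hlq : Real.log q ≤ j := by
          have h1 : Real.log q ≤ Real.log ((2 : ℝ) ^ (j + 1)) := by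
            apply Real.log_le_log hq0
            exact_mod_cast (by omega : q ≤ N)
          rw [Real.log_pow] at h1
          have h2 := Real.log_two_lt_d9
          have h3 : (60 : ℝ) ≤ j := by exact_mod_cast hj
          push_cast at h1
          nlinarith
        have hlq0 : 0 ≤ Real.log q := Real.log_nonneg hq1
        rw [div_lt_iff₀ (by positivity)]
        apply lt_of_pow_lt_pow_left₀ 2 (by positivity)
        calc w ^ 2 ≤ r := hr1'
          _ < (q : ℝ) ^ 2 * (Real.log q) ^ 4 := hlt
          _ ≤ (q : ℝ) ^ 2 * (j : ℝ) ^ 4 := by gcongr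
          _ = _ := by ring
      · by_contra hc
        push Not at hc
        have h1 : 2 * w / j < m := (Nat.floor_lt (by positivity)).1 hmK
        rw [div_lt_iff₀ hj0] at h1
        have hm0 : (0 : ℝ) < m := by exact_mod_cast hm1
        have h2 : w * j * m < q * m := by gcongr
        nlinarith
    · rw [Finset.mem_image]
      refine ⟨m, ?_, hrm.symm⟩
      rw [Finset.mem_filter, Finset.mem_Icc]
      refine ⟨⟨hm1, ?_⟩, hrm ▸ hrp⟩
      exact Nat.div_le_div_right hr2.le
  have c2 : (s2.card : ℝ) ≤ 321 * 320 * (2 ^ j * (Real.log j / (j : ℝ) ^ 2)) := by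
    have h1 : s2.card ≤ ∑ q ∈ Q, ((Finset.Icc 1 (N / q)).filter fun m => (q * m + 1).Prime).card :=
      (Finset.card_le_card hsub).trans (Finset.card_biUnion_le.trans
        (Finset.sum_le_sum fun q _ => Finset.card_image_le))
    have h1' : (s2.card : ℝ) ≤ ∑ q ∈ Q,
        (((Finset.Icc 1 (N / q)).filter fun m => (q * m + 1).Prime).card : ℝ) := by exact_mod_cast h1
    have h2 : ∀ q ∈ Q, (((Finset.Icc 1 (N / q)).filter fun m => (q * m + 1).Prime).card : ℝ) ≤
        (321 * 2 ^ j / j) * (1 / q) := by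
      intro q hq
      rw [hQ, Finset.mem_filter] at hq
      obtain ⟨_, hqp, hq1, hq2⟩ := hq
      have hq0 : (0 : ℝ) < q := by exact_mod_cast hqp.pos
      have hD1 : 1 ≤ D := Nat.one_le_two_pow
      have hDr : (D : ℝ) = 2 ^ h := by rw [hD]; push_cast; rfl
      rw [← hDr] at hgr
      have hD4 : (D : ℝ) ^ 4 ≤ w / (j : ℝ) ^ 2 := by
        rwa [le_div_iff₀ (by positivity)]
      have hDq : D < q := by
        have : (D : ℝ) ≤ (D : ℝ) ^ 4 := le_self_pow₀ (by exact_mod_cast hD1) (by norm_num)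
        exact_mod_cast (this.trans hD4).trans_lt hq1
      have hb := sieve_bound q D (N / q) hD1 hDq.le (fun d hd1 hd2 =>
        ((Nat.Prime.coprime_iff_not_dvd hqp).2 (fun hdv => by
          have := Nat.le_of_dvd hd1 hdv
          omega)).symm)
      refine hb.trans ?_
      have hS : (j : ℝ) / 160 ≤ sieveS D := by
        refine le_trans ?_ (sieveS_lower D)
        rw [hDr, Real.log_pow]
        have h2 := Real.log_two_gt_d9
        have h3 : (j : ℝ) ≤ 40 * h := by exact_mod_cast hh1
        nlinarith
      have hM : ((N / q : ℕ) : ℝ) ≤ 2 * 2 ^ j / q := by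
        refine Nat.cast_div_le.trans (le_of_eq ?_)
        rw [hN]; push_cast; rw [pow_succ']
      have t1 : ((N / q : ℕ) : ℝ) / sieveS D ≤ (2 * 2 ^ j / q) / (j / 160) := by gcongr
      have t2 : (D : ℝ) ^ 4 ≤ 2 ^ j / (j * q) := by
        refine hD4.trans ?_
        rw [← hww, div_le_div_iff₀ (by positivity) (by positivity)]
        calc w * (j * q) ≤ w * (j * (w * j)) := by gcongr
          _ = _ := by ring
      calc _ ≤ (2 * 2 ^ j / q) / ((j : ℝ) / 160) + 2 ^ j / (j * q) := add_le_add t1 t2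
        _ = _ := by field_simp; norm_num
    calc (s2.card : ℝ) ≤ ∑ q ∈ Q, (321 * 2 ^ j / (j : ℝ)) * (1 / q) := h1'.trans (Finset.sum_le_sum h2)
      _ = (321 * 2 ^ j / (j : ℝ)) * ∑ q ∈ Q, (1 : ℝ) / q := by rw [Finset.mul_sum]
      _ ≤ (321 * 2 ^ j / (j : ℝ)) * (320 * Real.log j / j) := by
          apply mul_le_mul_of_nonneg_left _ (by positivity)
          apply sum_window j hj
          intro q hq
          rw [hQ, Finset.mem_filter] at hq
          exact hq.2
      _ = _ := by field_simp
  rw [hcard]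
  push_cast
  linarith

/-! ### Assembly -/

open scoped Classical in
lemma natcard_eq (X : ℝ) (P : ℕ → Prop) :
    Nat.card {n : ℕ | 0 < n ∧ (n : ℝ) ≤ X ∧ P n} = ((Finset.Icc 1 ⌊X⌋₊).filter P).card := by
  rw [Nat.card_coe_set_eq, ← Set.ncard_coe_finset]
  congr 1
  ext n
  simp only [Set.mem_setOf_eq, Finset.coe_filter, Finset.mem_Icc]
  constructor
  · rintro ⟨h1, h2, h3⟩
    exact ⟨⟨h1, Nat.le_floor h2⟩, h3⟩
  · rintro ⟨⟨h1, h2⟩, h3⟩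
    exact ⟨h1, (Nat.le_floor_iff' (by omega)).1 h2, h3⟩

lemma card_mult (X : ℝ) (hX : 0 ≤ X) (d : ℕ) :
    (((Finset.Icc 1 ⌊X⌋₊).filter fun n => d ∣ n).card : ℝ) ≤ X * (1 / d) := by
  have : Finset.Icc 1 ⌊X⌋₊ = Finset.Ioc 0 ⌊X⌋₊ := by ext; simp; omega
  rw [this, Nat.Ioc_filter_dvd_card_eq_div, mul_one_div]
  refine Nat.cast_div_le.trans ?_
  gcongr
  exact Nat.floor_le hX

lemma not_perfect_power (a q : ℕ) (ha : 1 < a) (hq : a < q) : ¬ ∃ b : ℕ, b ^ q = a := by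
  rintro ⟨b, hb⟩
  rcases Nat.lt_or_ge b 2 with h | h
  · interval_cases b
    · rw [zero_pow (by omega)] at hb; omega
    · rw [one_pow] at hb; omega
  · have h1 : 2 ^ q ≤ b ^ q := Nat.pow_le_pow_left h q
    have h2 : q < 2 ^ q := Nat.lt_two_pow_self
    omega

lemma log_compare (z : ℝ) (I : ℕ) (hI : 3 ≤ I) (h1 : (2 : ℝ) ^ I ≤ z) (h2 : z < 2 ^ (I + 1)) :
    Real.log I / I ≤ 4 * (Real.log (Real.log z) / Real.log z) ∨ Real.log (Real.log z) < 1 := by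
  by_cases hz : Real.log (Real.log z) < 1
  · exact Or.inr hz
  left
  push Not at hz
  have hI0 : (3 : ℝ) ≤ I := by exact_mod_cast hI
  have hz0 : 0 < z := lt_of_lt_of_le (by positivity) h1
  have a1 := Real.log_le_log (by positivity) h1
  have a2 := Real.log_le_log hz0 h2.le
  rw [Real.log_pow] at a1 a2
  push_cast at a2
  have l1 := Real.log_two_gt_d9
  have l2 := Real.log_two_lt_d9
  have b1 : (I : ℝ) ≤ 2 * Real.log z := by nlinarith
  have b2 : Real.log z ≤ 2 * I := by nlinarith
  have hlz : 0 < Real.log z := by linarith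
  have b3 : Real.log I ≤ 2 * Real.log (Real.log z) := by
    have := Real.log_le_log (by positivity) b1
    rw [Real.log_mul (by norm_num) hlz.ne'] at this
    linarith
  calc Real.log I / I ≤ (2 * Real.log (Real.log z)) / (Real.log z / 2) := by
        gcongr
        linarith
    _ = _ := by field_simp; norm_num

theorem stmt4 (a : ℕ) (ha : 1 < a)
    (hLP : ∃ C : ℝ, ∀ q : ℕ, q.Prime → Odd q → (¬ ∃ b : ℕ, b ^ q = a) →
      ∀ X : ℝ, 3 ≤ X →
      (Nat.card {n : ℕ | 0 < n ∧ (n : ℝ) ≤ X ∧ ∃ r : ℕ, r.Prime ∧ r ∣ n ∧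
          r % q = 1 ∧ (a : ZMod r) ^ ((r - 1) / q) = 1 ∧
          (q : ℝ) ^ 2 * (Real.log q) ^ 4 ≤ (r : ℝ)} : ℝ) ≤
        C * (X / (q * Real.log q) + X * Real.log (Real.log X) / (q : ℝ) ^ 2)) :
    ∃ C' : ℝ, ∀ᶠ X : ℝ in atTop, ∀ z : ℝ,
      Real.log (Real.log X) ≤ z → z ≤ X ^ ((1 : ℝ) / 2) →
      (Nat.card {n : ℕ | 0 < n ∧ (n : ℝ) ≤ X ∧
          z ≤ (largestPrimeFactor (carmichael n / lstar a n) : ℝ)} : ℝ) ≤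
        C' * X * Real.log (Real.log z) / Real.log z := by
  classical
  obtain ⟨C, hC⟩ := hLP
  set C1 : ℝ := 4 * a + 321 * 320 with hC1
  have hC10 : 0 ≤ C1 := by positivity
  refine ⟨4 * (16 + 32 * |C| + 4 * C1), ?_⟩
  have hlim : Tendsto (fun X : ℝ => Real.log (Real.log X)) atTop atTop :=
    Real.tendsto_log_atTop.comp Real.tendsto_log_atTop
  have hlim2 : ∀ᶠ z : ℝ in atTop, 1 ≤ Real.log (Real.log z) := hlim.eventually_ge_atTop 1
  obtain ⟨z1, hz1⟩ := eventually_atTop.1 hlim2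
  filter_upwards [hlim.eventually_ge_atTop z1, hlim.eventually_ge_atTop ((2 : ℝ) ^ 60),
    hlim.eventually_ge_atTop ((a : ℝ) + 1), eventually_ge_atTop (3 : ℝ)] with X hX1 hX2 hX3 hX4 z hz _
  have hX0 : 0 ≤ X := by linarith
  have hLz : 1 ≤ Real.log (Real.log z) := hz1 z (hX1.trans hz)
  have hz60 : (2 : ℝ) ^ 60 ≤ z := hX2.trans hz
  have hza : (a : ℝ) + 1 ≤ z := hX3.trans hz
  have hzone : (1 : ℝ) < z := lt_of_lt_of_le (by norm_num) hz60
  have hz0 : 0 < z := by linarith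
  have hLX : 0 ≤ Real.log (Real.log X) := le_trans (by positivity) hX2
  -- the dyadic index of `z`
  set I := Nat.log 2 ⌊z⌋₊ with hI
  have hfz0 : ⌊z⌋₊ ≠ 0 := (Nat.floor_pos.2 hzone.le).ne'
  have hI1 : (2 : ℝ) ^ I ≤ z := (two_pow_log_le _ hfz0).trans (Nat.floor_le hz0.le)
  have hI2 : z < 2 ^ (I + 1) := by
    have h2 : ⌊z⌋₊ < 2 ^ (I + 1) := Nat.lt_pow_succ_log_self (by norm_num) _
    have h3 := Nat.lt_floor_add_one z
    have h4 : ((⌊z⌋₊ + 1 : ℕ) : ℝ) ≤ ((2 ^ (I + 1) : ℕ) : ℝ) := by exact_mod_cast h2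
    push_cast at h4
    linarith
  have hI60 : 60 ≤ I := by
    apply Nat.le_log_of_pow_le (by norm_num)
    apply Nat.le_floor
    exact_mod_cast hz60
  have hI0 : (0 : ℝ) < I := by exact_mod_cast (by omega : 0 < I)
  have hIlog : ∀ n : ℕ, z ≤ n → I ≤ Nat.log 2 n := by
    intro n hn
    apply Nat.log_mono_right
    have := Nat.floor_le_floor hn
    rwa [Nat.floor_natCast] at this
  set U := Finset.Icc 1 ⌊X⌋₊ with hU
  set Q := U.filter fun q : ℕ => q.Prime ∧ z ≤ q with hQ
  set R := U.filter fun r : ℕ => z ≤ r ∧ r.Prime ∧ ∃ q : ℕ, q.Prime ∧ r % q = 1 ∧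
      (a : ZMod r) ^ ((r - 1) / q) = 1 ∧ (r : ℝ) < (q : ℝ) ^ 2 * (Real.log q) ^ 4 with hR
  set LP : ℕ → Finset ℕ := fun q => U.filter fun n => ∃ r : ℕ, r.Prime ∧ r ∣ n ∧
          r % q = 1 ∧ (a : ZMod r) ^ ((r - 1) / q) = 1 ∧
          (q : ℝ) ^ 2 * (Real.log q) ^ 4 ≤ (r : ℝ) with hLPdef
  have hQs : ∀ q ∈ Q, q.Prime ∧ I ≤ Nat.log 2 q := by
    intro q hq
    rw [hQ, Finset.mem_filter] at hq
    exact ⟨hq.2.1, hIlog q hq.2.2⟩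
  rw [natcard_eq X (fun n => z ≤ (largestPrimeFactor (carmichael n / lstar a n) : ℝ))]
  have hcover : U.filter (fun n => z ≤ (largestPrimeFactor (carmichael n / lstar a n) : ℝ)) ⊆
      (Q.biUnion fun q => U.filter fun n => q ^ 2 ∣ n) ∪ (Q.biUnion LP) ∪
        (R.biUnion fun r => U.filter fun n => r ∣ n) := by
    intro n hn
    rw [Finset.mem_filter] at hn
    obtain ⟨hnU, hnz⟩ := hn
    have hnU' := Finset.mem_Icc.1 hnU
    set m := carmichael n / lstar a n with hm
    obtain ⟨q, hqm, hqz⟩ : ∃ q ∈ m.primeFactors, z ≤ (q : ℝ) := by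
      by_contra hcon
      push Not at hcon
      have : (largestPrimeFactor m : ℝ) < z := by
        unfold largestPrimeFactor
        rw [Nat.cast_max, max_lt_iff]
        refine ⟨by simpa using hzone, ?_⟩
        rcases m.primeFactors.eq_empty_or_nonempty with h | h
        · rw [h]; simpa using hz0
        · obtain ⟨p, hp, he⟩ := Finset.exists_mem_eq_sup _ h (id : ℕ → ℕ)
          rw [he]
          exact hcon p hp
      linarith
    have hqp := Nat.prime_of_mem_primeFactors hqm
    have hqd := Nat.dvd_of_mem_primeFactors hqm
    have hqa : a < q := by
      have : (a : ℝ) < q := by linarith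
      exact_mod_cast this
    have hUof : ∀ d : ℕ, 0 < d → d ≤ n → d ∈ U := fun d h1 h2 =>
      Finset.mem_Icc.2 ⟨h1, h2.trans hnU'.2⟩
    rw [Finset.mem_union, Finset.mem_union, Finset.mem_biUnion, Finset.mem_biUnion, Finset.mem_biUnion]
    rcases alg_key a n q ha hnU'.1 hqp hqa hqd with h | ⟨r, hr, hrn, hmod, hpow⟩
    · left; left
      have hqn : q ∣ n := (dvd_pow_self q two_ne_zero).trans h
      exact ⟨q, Finset.mem_filter.2 ⟨hUof q hqp.pos (Nat.le_of_dvd hnU'.1 hqn), hqp, hqz⟩,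
        Finset.mem_filter.2 ⟨hnU, h⟩⟩
    · have hrle : r ≤ n := Nat.le_of_dvd hnU'.1 hrn
      have hqr : q ≤ r := by
        by_contra hc
        rw [Nat.mod_eq_of_lt (not_le.1 hc)] at hmod
        exact hr.one_lt.ne' hmod
      by_cases hbig : (q : ℝ) ^ 2 * (Real.log q) ^ 4 ≤ (r : ℝ)
      · left; right
        exact ⟨q, Finset.mem_filter.2 ⟨hUof q hqp.pos (hqr.trans hrle), hqp, hqz⟩,
          Finset.mem_filter.2 ⟨hnU, r, hr, hrn, hmod, hpow, hbig⟩⟩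
      · right
        have hqr' : (q : ℝ) ≤ r := by exact_mod_cast hqr
        exact ⟨r, Finset.mem_filter.2 ⟨hUof r hr.pos hrle, hqz.trans hqr', hr, q, hqp, hmod, hpow,
          not_le.1 hbig⟩, Finset.mem_filter.2 ⟨hnU, hrn⟩⟩
  have hcard : ((U.filter (fun n => z ≤ (largestPrimeFactor (carmichael n / lstar a n) : ℝ))).card : ℝ) ≤
      ∑ q ∈ Q, ((U.filter fun n => q ^ 2 ∣ n).card : ℝ) + ∑ q ∈ Q, ((LP q).card : ℝ) +
        ∑ r ∈ R, ((U.filter fun n => r ∣ n).card : ℝ) := by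
    have h1 := (Finset.card_le_card hcover).trans (Finset.card_union_le _ _)
    have h2 := Finset.card_union_le (Q.biUnion fun q => U.filter fun n => q ^ 2 ∣ n) (Q.biUnion LP)
    have h3 := Finset.card_biUnion_le (s := Q) (t := fun q => U.filter fun n => q ^ 2 ∣ n)
    have h4 := Finset.card_biUnion_le (s := Q) (t := LP)
    have h5 := Finset.card_biUnion_le (s := R) (t := fun r => U.filter fun n => r ∣ n)
    have h6 : (U.filter (fun n => z ≤ (largestPrimeFactor (carmichael n / lstar a n) : ℝ))).card ≤
      ∑ q ∈ Q, (U.filter fun n => q ^ 2 ∣ n).card + ∑ q ∈ Q, (LP q).card +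
        ∑ r ∈ R, (U.filter fun n => r ∣ n).card := by omega
    exact_mod_cast h6
  refine hcard.trans ?_
  have hsq := sum_prime_inv_sq Q I (by omega) hQs
  have hlg := sum_prime_inv_log Q I (by omega) hQs
  have hsqz : ∑ q ∈ Q, (1 : ℝ) / (q : ℝ) ^ 2 ≤ 16 / (I * z) := by
    refine hsq.trans ?_
    rw [div_le_div_iff₀ (by positivity) (by positivity)]
    rw [pow_succ] at hI2
    nlinarith
  have s1 : ∑ q ∈ Q, ((U.filter fun n => q ^ 2 ∣ n).card : ℝ) ≤ X * (16 / I) := by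
    calc _ ≤ ∑ q ∈ Q, X * (1 / (q : ℝ) ^ 2) := by
          apply Finset.sum_le_sum
          intro q _
          have := card_mult X hX0 (q ^ 2)
          push_cast at this
          exact this
      _ = X * ∑ q ∈ Q, (1 : ℝ) / (q : ℝ) ^ 2 := by rw [Finset.mul_sum]
      _ ≤ X * (16 / I) := by
          apply mul_le_mul_of_nonneg_left _ hX0
          refine hsqz.trans ?_
          apply div_le_div_of_nonneg_left (by norm_num) hI0
          nlinarith
  have s2 : ∑ q ∈ Q, ((LP q).card : ℝ) ≤ X * (32 * |C| / I) := by
    calc _ ≤ ∑ q ∈ Q, (|C| * X * (1 / ((q : ℝ) * Real.log q)) +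
            |C| * X * Real.log (Real.log X) * (1 / (q : ℝ) ^ 2)) := by
          apply Finset.sum_le_sum
          intro q hq
          have hq' := hq
          rw [hQ, Finset.mem_filter] at hq'
          obtain ⟨_, hqp, hqz⟩ := hq'
          have hqa : a < q := by
            have : (a : ℝ) < q := by linarith
            exact_mod_cast this
          have := hC q hqp (hqp.odd_of_ne_two (by omega)) (not_perfect_power a q ha hqa) X hX4
          rw [natcard_eq X (fun n => ∃ r : ℕ, r.Prime ∧ r ∣ n ∧
            r % q = 1 ∧ (a : ZMod r) ^ ((r - 1) / q) = 1 ∧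
            (q : ℝ) ^ 2 * (Real.log q) ^ 4 ≤ (r : ℝ))] at this
          refine this.trans ?_
          have hq1 : (1 : ℝ) ≤ q := by linarith
          have hlq : 0 ≤ Real.log q := Real.log_nonneg hq1
          have hnn : 0 ≤ X / (q * Real.log q) + X * Real.log (Real.log X) / (q : ℝ) ^ 2 := by
            positivity
          calc _ ≤ |C| * (X / (q * Real.log q) + X * Real.log (Real.log X) / (q : ℝ) ^ 2) :=
                mul_le_mul_of_nonneg_right (le_abs_self C) hnn
            _ = _ := by ring
      _ = |C| * X * ∑ q ∈ Q, (1 / ((q : ℝ) * Real.log q)) +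
            |C| * X * (Real.log (Real.log X) * ∑ q ∈ Q, (1 / (q : ℝ) ^ 2)) := by
          rw [Finset.sum_add_distrib, ← Finset.mul_sum, ← Finset.mul_sum]
          ring
      _ ≤ |C| * X * (16 / I) + |C| * X * (16 / I) := by
          have : Real.log (Real.log X) * ∑ q ∈ Q, (1 / (q : ℝ) ^ 2) ≤ 16 / I := by
            calc _ ≤ z * (16 / (I * z)) := by
                  apply mul_le_mul hz hsqz (Finset.sum_nonneg fun q _ => by positivity) hz0.le
              _ = _ := by field_simp
          gcongr
      _ = _ := by ring
  have s3 : ∑ r ∈ R, ((U.filter fun n => r ∣ n).card : ℝ) ≤ X * (C1 * (2 * (Real.log I + 1) / I)) := by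
    calc _ ≤ ∑ r ∈ R, X * (1 / (r : ℝ)) := by
          apply Finset.sum_le_sum
          intro r _
          exact card_mult X hX0 r
      _ = X * ∑ r ∈ R, (1 : ℝ) / (r : ℝ) := by rw [Finset.mul_sum]
      _ ≤ X * (C1 * (2 * (Real.log I + 1) / I)) := by
          apply mul_le_mul_of_nonneg_left _ hX0
          refine (dyadic_sum R _ (fun i => C1 * (2 ^ i * (Real.log i / (i : ℝ) ^ 2)))
            (fun i => 1 / ((2 : ℝ) ^ i)) I (R.sup (Nat.log 2)) ?_ ?_ (fun i _ => by positivity) ?_).trans ?_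
          · intro r hr
            refine ⟨?_, Finset.le_sup (f := Nat.log 2) hr⟩
            rw [hR, Finset.mem_filter] at hr
            exact hIlog r hr.2.1
          · intro r hr
            rw [hR, Finset.mem_filter] at hr
            have := two_pow_log_le r hr.2.2.1.ne_zero
            gcongr
          · intro i hi
            apply bad_primes a ha i (by omega)
            intro r hr
            rw [Finset.mem_filter] at hr
            obtain ⟨hr, hri⟩ := hr
            rw [hR, Finset.mem_filter] at hr
            exact ⟨hri, hr.2.2.1, hr.2.2.2⟩
          · calc _ ≤ ∑ i ∈ Finset.Icc I (R.sup (Nat.log 2)), C1 * (Real.log i / (i : ℝ) ^ 2) := by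
                  refine le_of_eq (Finset.sum_congr rfl fun i _ => ?_)
                  field_simp
              _ ≤ C1 * (2 * (Real.log I + 1) / I) := by
                  rw [← Finset.mul_sum]
                  exact mul_le_mul_of_nonneg_left (tail_log_sq _ _ (by omega)) hC10
  have hlI := one_le_log_of I (by omega)
  have hfin : Real.log I / I ≤ 4 * (Real.log (Real.log z) / Real.log z) := by
    rcases log_compare z I (by omega) hI1 hI2 with h | h
    · exact h
    · linarith
  have hC0 := abs_nonneg C
  calc _ ≤ X * (16 / I) + X * (32 * |C| / I) + X * (C1 * (2 * (Real.log I + 1) / I)) := by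
        linarith
    _ = X * ((16 + 32 * |C| + 2 * C1 * (Real.log I + 1)) / I) := by ring
    _ ≤ X * (((16 + 32 * |C| + 4 * C1) * Real.log I) / I) := by
        gcongr
        nlinarith
    _ = X * (16 + 32 * |C| + 4 * C1) * (Real.log I / I) := by ring
    _ ≤ X * (16 + 32 * |C| + 4 * C1) * (4 * (Real.log (Real.log z) / Real.log z)) := by
        gcongr
    _ = _ := by ring
end
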